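/- arXiv:2408.07182 — 5 statements merged into one kernel-verified Lean document; each statement's English description precedes it below -/
import Mathlib

section
/- Let the standing assumptions hold, let ε > 0 and x₀ ∈ dom Φ. Assume there exists an absolutely continuous x : [0,∞) → ℝ^d with derivative u, x(0) = x₀, u(t) ∈ −D_Φ(x(t)) for almost every t, that this solution is unique (any other absolutely continuous function on [0,∞) with the same initial condition whose derivative lies in −D_Φ along the curve almost everywhere coincides with x), and that x(t) converges to some limit as t → ∞. Then there exists T₀ ≥ 0 such that for every T ≥ T₀ there exists ᾱ > 0 such that every proximal-random-reshuffling sequence (x_k) initialized at x₀ with step sizes α_k ∈ (0, ᾱ] and Σ_{k=0}^∞ α_k = T converges to a limit x* that is (ε,0)-near approximate D_Φ-stationary, i.e. inf{‖v‖ : v ∈ D_Φ(y) for some y with ‖y − x*‖ ≤ ε} = 0. -/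
open scoped RealInnerProductSpace
open MeasureTheory

noncomputable section

/-- Euclidean space ℝ^d. -/
abbrev Euc (d : ℕ) := EuclideanSpace ℝ (Fin d)

/-- Convex subdifferential of an extended-real-valued function. -/
def Subdiff {d : ℕ} (g : Euc d → EReal) (x : Euc d) : Set (Euc d) :=
  {v | ∀ y : Euc d, g x + ((⟪v, y - x⟫ : ℝ) : EReal) ≤ g y}

/-- Proper: somewhere finite and never −∞. -/
def ProperFn {d : ℕ} (g : Euc d → EReal) : Prop :=
  (∃ x, g x ≠ ⊤) ∧ ∀ x, g x ≠ ⊥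

/-- Convexity via the epigraph. -/
def ConvexFn {d : ℕ} (g : Euc d → EReal) : Prop :=
  Convex ℝ {p : Euc d × ℝ | g p.1 ≤ (p.2 : EReal)}

/-- Locally Lipschitz on the domain `{x | g x ≠ ⊤}`. -/
def LocLipOnDom {d : ℕ} (g : Euc d → EReal) : Prop :=
  ∀ x : Euc d, g x ≠ ⊤ → ∃ ε > (0:ℝ), ∃ K : ℝ, ∀ y : Euc d, g y ≠ ⊤ → ∀ z : Euc d, g z ≠ ⊤ →
    ‖y - x‖ ≤ ε → ‖z - x‖ ≤ ε → |(g y).toReal - (g z).toReal| ≤ K * ‖y - z‖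

/-- A set-valued map is locally bounded. -/
def LocBounded {d : ℕ} (F : Euc d → Set (Euc d)) : Prop :=
  ∀ x : Euc d, ∃ ε > (0:ℝ), Bornology.IsBounded (⋃ y ∈ Metric.ball x ε, F y)

/-- `D` is a conservative field for the locally Lipschitz function `f : ℝ^d → ℝ`. -/
def IsConservativeFieldR {d : ℕ} (D : Euc d → Set (Euc d)) (f : Euc d → ℝ) : Prop :=
  IsClosed {p : Euc d × Euc d | p.2 ∈ D p.1} ∧
  ∀ x u : ℝ → Euc d, IntervalIntegrable u volume 0 1 →
    (∀ t ∈ Set.Icc (0:ℝ) 1, x t = x 0 + ∫ s in (0:ℝ)..t, u s) →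
    (∀ t ∈ Set.Icc (0:ℝ) 1, (D (x t)).Nonempty) →
    ∀ᵐ t ∂volume, t ∈ Set.Ioo (0:ℝ) 1 →
      ∀ v ∈ D (x t), HasDerivAt (fun s => f (x s)) (⟪v, u t⟫ : ℝ) t

/-- The objective `Φ = f₁ + ⋯ + f_N + g`. -/
def Phi {d : ℕ} (N : ℕ) (f : Fin N → Euc d → ℝ) (g : Euc d → EReal) (x : Euc d) : EReal :=
  ((∑ i, f i x : ℝ) : EReal) + g x

/-- The field `D_Φ = D₁ + ⋯ + D_N + ∂g` (pointwise Minkowski sum). -/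
def DPhi {d : ℕ} (N : ℕ) (D : Fin N → Euc d → Set (Euc d)) (g : Euc d → EReal)
    (x : Euc d) : Set (Euc d) :=
  {w : Euc d | ∃ v : Fin N → Euc d, (∀ i, v i ∈ D i x) ∧
    ∃ s ∈ Subdiff g x, w = (∑ i, v i) + s}

/-- `(α, x)` is a proximal random reshuffling sequence: at each outer iteration `k`
there are a permutation `σ` and inner iterates `z` performing one subgradient step
for each `D_{σ(i)}` followed by a proximal step for `g`
(`x (k+1)` minimizes `w ↦ g w + ‖w − z_N‖²/(2 α_k)`). -/
def IsPRR {d : ℕ} (N : ℕ) (D : Fin N → Euc d → Set (Euc d)) (g : Euc d → EReal)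
    (α : ℕ → ℝ) (x : ℕ → Euc d) : Prop :=
  ∀ k : ℕ, ∃ (σ : Equiv.Perm (Fin N)) (z : ℕ → Euc d),
    z 0 = x k ∧
    (∀ i : Fin N, ∃ v ∈ D (σ i) (z i.1), z (i.1 + 1) = z i.1 - α k • v) ∧
    (∀ w : Euc d,
      g (x (k+1)) + ((‖x (k+1) - z N‖ ^ 2 / (2 * α k) : ℝ) : EReal) ≤
        g w + ((‖w - z N‖ ^ 2 / (2 * α k) : ℝ) : EReal))

/-- Standing assumptions of the paper: each `f_i` is locally Lipschitz, each `D_i`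
is a locally bounded conservative field for `f_i` with nonempty convex values,
`g` is proper, convex, with closed domain and locally Lipschitz on its domain,
and `Φ = f₁ + ⋯ + f_N + g` is bounded below. -/
def StandingAssumptions {d : ℕ} (N : ℕ) (f : Fin N → Euc d → ℝ)
    (D : Fin N → Euc d → Set (Euc d)) (g : Euc d → EReal) : Prop :=
  (∀ i, LocallyLipschitz (f i)) ∧
  (∀ i, IsConservativeFieldR (D i) (f i)) ∧
  (∀ i, LocBounded (D i)) ∧
  (∀ i x, (D i x).Nonempty ∧ Convex ℝ (D i x)) ∧
  ProperFn g ∧ ConvexFn g ∧ IsClosed {x : Euc d | g x ≠ ⊤} ∧ LocLipOnDom g ∧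
  ∃ c : ℝ, ∀ x : Euc d, (c : EReal) ≤ Phi N f g x

/-- `(x, u)` is a global solution on `[0,∞)` of `x' ∈ −D_Φ(x)` with `x(0) = x₀`. -/
def IsDPhiTrajectory {d : ℕ} (N : ℕ) (D : Fin N → Euc d → Set (Euc d))
    (g : Euc d → EReal) (x₀ : Euc d) (x u : ℝ → Euc d) : Prop :=
  (∀ T ≥ (0:ℝ), IntervalIntegrable u volume 0 T) ∧
  x 0 = x₀ ∧
  (∀ t ≥ (0:ℝ), x t = x 0 + ∫ s in (0:ℝ)..t, u s) ∧
  (∀ᵐ t ∂volume, 0 < t → -u t ∈ DPhi N D g (x t))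

open Filter Topology Set

section Compactness

theorem Ultrafilter.exists_tendsto_of_eventually_norm_le {E ι : Type*} [NormedAddCommGroup E]
    [ProperSpace E] (U : Ultrafilter ι) {a : ι → E} {R : ℝ} (h : ∀ᶠ n in U, ‖a n‖ ≤ R) :
    ∃ x, Tendsto a U (𝓝 x) := by
  have hK : IsCompact (Metric.closedBall (0 : E) R) := isCompact_closedBall 0 R
  obtain ⟨x, -, hx⟩ := hK.ultrafilter_le_nhds' (U.map a) (by
    change ∀ᶠ n in U, a n ∈ Metric.closedBall (0 : E) R
    simpa using h)
  exact ⟨x, hx⟩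

theorem LocBounded.exists_norm_le_of_isCompact {d : ℕ} {F : Euc d → Set (Euc d)}
    (hF : LocBounded F) {K : Set (Euc d)} (hK : IsCompact K) :
    ∃ L : ℝ, 0 ≤ L ∧ ∀ p ∈ K, ∀ v ∈ F p, ‖v‖ ≤ L := by
  refine hK.induction_on (p := fun s => ∃ L : ℝ, 0 ≤ L ∧ ∀ p ∈ s, ∀ v ∈ F p, ‖v‖ ≤ L)
    ⟨0, le_rfl, by simp⟩ ?_ ?_ ?_
  · rintro s t hst ⟨L, hL0, hL⟩
    exact ⟨L, hL0, fun p hp => hL p (hst hp)⟩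
  · rintro s t ⟨L, hL0, hL⟩ ⟨M, hM0, hM⟩
    refine ⟨max L M, hL0.trans (le_max_left _ _), fun p hp v hv => ?_⟩
    rcases hp with hp | hp
    · exact (hL p hp v hv).trans (le_max_left _ _)
    · exact (hM p hp v hv).trans (le_max_right _ _)
  · intro x _
    obtain ⟨ε, hε, hb⟩ := hF x
    obtain ⟨L, hL⟩ := hb.exists_norm_le
    refine ⟨Metric.ball x ε, mem_nhdsWithin_of_mem_nhds (Metric.ball_mem_nhds x hε), max L 0,
      le_max_right _ _, fun p hp v hv => (hL v ?_).trans (le_max_left _ _)⟩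
    exact mem_iUnion₂.2 ⟨p, hp, hv⟩

theorem exists_norm_le_of_locBounded_family {d N : ℕ} {D : Fin N → Euc d → Set (Euc d)}
    (hD : ∀ i, LocBounded (D i)) {K : Set (Euc d)} (hK : IsCompact K) :
    ∃ L : ℝ, 0 ≤ L ∧ ∀ i, ∀ p ∈ K, ∀ v ∈ D i p, ‖v‖ ≤ L := by
  choose L hL0 hL using fun i => (hD i).exists_norm_le_of_isCompact hK
  refine ⟨∑ i, L i, Finset.sum_nonneg fun i _ => hL0 i, fun i p hp v hv => (hL i p hp v hv).trans ?_⟩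
  exact Finset.single_le_sum (fun j _ => hL0 j) (Finset.mem_univ i)

end Compactness

section RealValued

variable {d N : ℕ}

/-- Convex subdifferential of a real-valued function `G` restricted to the set `S`. -/
def SubdiffOn (S : Set (Euc d)) (G : Euc d → ℝ) (x : Euc d) : Set (Euc d) :=
  {v | x ∈ S ∧ ∀ y ∈ S, G x + ⟪v, y - x⟫ ≤ G y}

/-- The field `D₁ + ⋯ + D_N + ∂(G + indicator of S)`. -/
def SumField (D : Fin N → Euc d → Set (Euc d)) (S : Set (Euc d)) (G : Euc d → ℝ)
    (x : Euc d) : Set (Euc d) :=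
  {w | ∃ v : Fin N → Euc d, (∀ i, v i ∈ D i x) ∧ ∃ s ∈ SubdiffOn S G x, w = (∑ i, v i) + s}

/-- The standing assumptions with `g` replaced by a real-valued function `G` on a closed convex
set `S`, and with an explicit lower bound `c` of the objective. -/
structure RealAssumptions (f : Fin N → Euc d → ℝ) (D : Fin N → Euc d → Set (Euc d))
    (S : Set (Euc d)) (G : Euc d → ℝ) (c : ℝ) : Prop where
  lipschitz : ∀ i, LocallyLipschitz (f i)
  conservative : ∀ i, IsConservativeFieldR (D i) (f i)
  locBounded : ∀ i, LocBounded (D i)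
  nonempty : ∀ i x, (D i x).Nonempty
  convex : ∀ i x, Convex ℝ (D i x)
  isClosed : IsClosed S
  convexOn : ConvexOn ℝ S G
  lipschitzOn : LocallyLipschitzOn S G
  le_objective : ∀ x ∈ S, c ≤ ∑ i, f i x + G x

variable {f : Fin N → Euc d → ℝ} {D : Fin N → Euc d → Set (Euc d)} {S : Set (Euc d)}
  {G : Euc d → ℝ} {c : ℝ}

theorem SubdiffOn.convex (x : Euc d) : Convex ℝ (SubdiffOn S G x) := by
  rintro v ⟨hx, hv⟩ w ⟨_, hw⟩ a b ha hb hab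
  refine ⟨hx, fun y hy => ?_⟩
  rw [inner_add_left, real_inner_smul_left, real_inner_smul_left]
  have h1 := mul_le_mul_of_nonneg_left (hv y hy) ha
  have h2 := mul_le_mul_of_nonneg_left (hw y hy) hb
  obtain rfl : b = 1 - a := by linarith
  linarith

theorem RealAssumptions.convex_sumField (h : RealAssumptions f D S G c) (x : Euc d) :
    Convex ℝ (SumField D S G x) := by
  rintro _ ⟨v, hv, s, hs, rfl⟩ _ ⟨w, hw, r, hr, rfl⟩ a b ha hb hab
  refine ⟨fun i => a • v i + b • w i, fun i => h.convex i x (hv i) (hw i) ha hb hab,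
    a • s + b • r, SubdiffOn.convex x hs hr ha hb hab, ?_⟩
  simp only [Finset.sum_add_distrib, smul_add, Finset.smul_sum]
  abel

/-- Closedness of the graph of the sum field, the summands being taken at distinct points. -/
theorem RealAssumptions.mem_sumField_of_tendsto (h : RealAssumptions f D S G c)
    (U : Ultrafilter ℕ) {x w : Euc d} {p : ℕ → Fin N → Euc d} {q : ℕ → Euc d}
    {v : ℕ → Fin N → Euc d} {s : ℕ → Euc d}
    (hp : ∀ i, Tendsto (fun n => p n i) U (𝓝 x)) (hq : Tendsto q U (𝓝 x))
    (hv : ∀ n i, v n i ∈ D i (p n i)) (hs : ∀ n, s n ∈ SubdiffOn S G (q n))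
    (hw : Tendsto (fun n => ∑ i, v n i + s n) U (𝓝 w)) : w ∈ SumField D S G x := by
  have hlim : ∀ i, ∃ z, Tendsto (fun n => v n i) U (𝓝 z) := by
    intro i
    obtain ⟨ε, hε, hb⟩ := h.locBounded i x
    obtain ⟨L, hL⟩ := hb.exists_norm_le
    refine U.exists_tendsto_of_eventually_norm_le (R := L) ?_
    filter_upwards [(hp i).eventually (Metric.ball_mem_nhds x hε)] with n hn
    exact hL _ (mem_iUnion₂.2 ⟨p n i, hn, hv n i⟩)
  choose z hz using hlim
  have hsum : Tendsto (fun n => ∑ i, v n i) U (𝓝 (∑ i, z i)) :=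
    tendsto_finsetSum _ fun i _ => hz i
  have hs' : Tendsto s U (𝓝 (w - ∑ i, z i)) := by
    simpa using hw.sub hsum
  have hxS : x ∈ S := h.isClosed.mem_of_tendsto hq (Eventually.of_forall fun n => (hs n).1)
  have hqS : Tendsto q U (𝓝[S] x) :=
    tendsto_nhdsWithin_iff.2 ⟨hq, Eventually.of_forall fun n => (hs n).1⟩
  refine ⟨z, fun i => ?_, w - ∑ i, z i, ⟨hxS, fun y hy => ?_⟩, by abel⟩
  · exact (h.conservative i).1.mem_of_tendsto ((hp i).prodMk_nhds (hz i))
      (Eventually.of_forall fun n => hv n i)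
  · have hG : Tendsto (fun n => G (q n)) U (𝓝 (G x)) :=
      (h.lipschitzOn.continuousOn x hxS).tendsto.comp hqS
    refine le_of_tendsto (hG.add (hs'.inner (tendsto_const_nhds.sub hq)))
      (Eventually.of_forall fun n => (hs n).2 y hy)

theorem RealAssumptions.isClosed_sumField (h : RealAssumptions f D S G c) (x : Euc d) :
    IsClosed (SumField D S G x) := by
  refine isClosed_of_closure_subset fun w hw => ?_
  obtain ⟨a, ha, hlim⟩ := mem_closure_iff_seq_limit.1 hw
  choose v hv s hs has using ha
  refine h.mem_sumField_of_tendsto (hyperfilter ℕ) (p := fun _ _ => x) (q := fun _ => x)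
    (fun i => tendsto_const_nhds) tendsto_const_nhds hv hs ?_
  refine (hlim.mono_left Nat.hyperfilter_le_atTop).congr fun n => has n

/-- Upper semicontinuity of the sum field on bounded sets. -/
theorem RealAssumptions.exists_mem_cthickening (h : RealAssumptions f D S G c) (x : Euc d)
    (C : ℝ) {η : ℝ} (hη : 0 < η) :
    ∃ δ > 0, ∀ (p : Fin N → Euc d) (q : Euc d) (v : Fin N → Euc d) (s : Euc d),
      (∀ i, ‖p i - x‖ ≤ δ) → ‖q - x‖ ≤ δ → (∀ i, v i ∈ D i (p i)) → s ∈ SubdiffOn S G q →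
      ‖∑ i, v i + s‖ ≤ C → ∑ i, v i + s ∈ Metric.cthickening η (SumField D S G x) := by
  by_contra! hcon
  choose p q v s hp hq hv hs hC hn using fun n : ℕ =>
    hcon (1 / ((n : ℝ) + 1)) Nat.one_div_pos_of_nat
  have hU : (hyperfilter ℕ : Filter ℕ) ≤ atTop := Nat.hyperfilter_le_atTop
  have h0 := (tendsto_one_div_add_atTop_nhds_zero_nat (𝕜 := ℝ)).mono_left hU
  obtain ⟨w, hw⟩ := (hyperfilter ℕ).exists_tendsto_of_eventually_norm_le
    (Eventually.of_forall hC)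
  have hmem := h.mem_sumField_of_tendsto (hyperfilter ℕ) (x := x)
    (fun i => tendsto_iff_norm_sub_tendsto_zero.2
      (squeeze_zero (fun _ => norm_nonneg _) (fun n => hp n i) h0))
    (tendsto_iff_norm_sub_tendsto_zero.2 (squeeze_zero (fun _ => norm_nonneg _) hq h0)) hv hs hw
  have hnhds : Metric.cthickening η (SumField D S G x) ∈ 𝓝 w :=
    mem_of_superset (Metric.isOpen_thickening.mem_nhds
      (Metric.self_subset_thickening hη _ hmem)) (Metric.thickening_subset_cthickening _ _)
  obtain ⟨n, hn'⟩ := (hw.eventually hnhds).exists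
  exact hn n hn'

end RealValued

section Energy

theorem LipschitzWith.intervalIntegrable_deriv {E : Type*} [NormedAddCommGroup E]
    [NormedSpace ℝ E] [FiniteDimensional ℝ E] {K : NNReal} {x : ℝ → E} (hx : LipschitzWith K x)
    (a b : ℝ) : IntervalIntegrable (deriv x) volume a b := by
  have : CompleteSpace E := FiniteDimensional.complete ℝ E
  borelize E
  have : ProperSpace E := FiniteDimensional.proper_real E
  refine (intervalIntegrable_const (c := (K : ℝ))).mono_fun
    (stronglyMeasurable_deriv x).aestronglyMeasurable (Eventually.of_forall fun t => ?_)
  simpa using norm_deriv_le_of_lipschitz hx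

theorem LipschitzWith.integral_deriv_eq_sub {E : Type*} [NormedAddCommGroup E]
    [NormedSpace ℝ E] [FiniteDimensional ℝ E] {K : NNReal} {x : ℝ → E} (hx : LipschitzWith K x)
    (a b : ℝ) : ∫ t in a..b, deriv x t = x b - x a := by
  have : CompleteSpace E := FiniteDimensional.complete ℝ E
  have hint := hx.intervalIntegrable_deriv
  have hI : LipschitzWith K fun t => ∫ s in a..t, deriv x s := by
    refine LipschitzWith.of_dist_le_mul fun t r => ?_
    rw [dist_eq_norm, intervalIntegral.integral_interval_sub_left (hint _ _) (hint _ _),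
      Real.dist_eq]
    exact intervalIntegral.norm_integral_le_of_norm_le_const
      fun s _ => norm_deriv_le_of_lipschitz hx
  have hac := ((hx.sub hI).lipschitzOnWith (s := uIcc a b)).absolutelyContinuousOnInterval
  obtain ⟨C, hC⟩ := hac.const_of_ae_hasDerivAt_zero (by
    filter_upwards [hx.ae_differentiableAt_real, (hint a b).ae_hasDerivAt_integral]
      with t h1 h2 h3
    simpa only [sub_self] using h1.hasDerivAt.fun_sub (h2 h3 a left_mem_uIcc))
  have h1 := hC a left_mem_uIcc
  have h2 := hC b right_mem_uIcc
  simp only [intervalIntegral.integral_same, sub_zero] at h1 h2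
  rw [h1, ← h2]
  abel

variable {d N : ℕ}

theorem IsConservativeFieldR.ae_hasDerivAt {D : Euc d → Set (Euc d)} {f : Euc d → ℝ}
    (h : IsConservativeFieldR D f) (hne : ∀ x, (D x).Nonempty) {K : NNReal} {x : ℝ → Euc d}
    (hx : LipschitzWith K x) {T : ℝ} (hT : 0 < T) :
    ∀ᵐ t, t ∈ Ioo 0 T → ∀ v ∈ D (x t), HasDerivAt (fun s => f (x s)) ⟪v, deriv x t⟫ t := by
  have hy : LipschitzWith (K * ‖T‖₊) fun s => x (T * s) := by
    refine hx.comp (LipschitzWith.of_dist_le_mul fun s r => ?_)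
    simp [Real.dist_eq, ← mul_sub, abs_mul]
  have key := h.2 (fun s => x (T * s)) (deriv fun s => x (T * s))
    (hy.intervalIntegrable_deriv 0 1)
    (fun t _ => by rw [hy.integral_deriv_eq_sub]; abel) (fun t _ => hne _)
  have hq : Measure.QuasiMeasurePreserving (fun t : ℝ => T⁻¹ * t) := by
    refine ⟨by fun_prop, ?_⟩
    rw [Real.map_volume_mul_left (inv_ne_zero hT.ne')]
    exact Measure.smul_absolutelyContinuous
  filter_upwards [hq.ae key] with t ht htT v hv
  have hTt : T * (T⁻¹ * t) = t := by field_simp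
  have h1 := ht ⟨by have := htT.1; positivity, by
    rw [inv_mul_lt_iff₀ hT]; linarith [htT.2]⟩ v (by rwa [hTt])
  rw [deriv_comp_mul_left, hTt, real_inner_smul_right] at h1
  have h2 := h1.scomp t ((hasDerivAt_id t).const_mul T⁻¹)
  convert! h2 using 1
  · ext s
    simp [Function.comp, mul_inv_cancel_left₀ hT.ne']
  · simp [inv_mul_cancel_left₀ hT.ne']

variable {f : Fin N → Euc d → ℝ} {D : Fin N → Euc d → Set (Euc d)} {S : Set (Euc d)}
  {G : Euc d → ℝ} {c : ℝ}

/-- Lipschitz solutions on `[0, T]` of `x' ∈ -(D₁ + ⋯ + D_N + ∂(G + indicator of S))(x)`. -/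
structure IsLipschitzSolution (D : Fin N → Euc d → Set (Euc d)) (S : Set (Euc d))
    (G : Euc d → ℝ) (T : ℝ) (x : ℝ → Euc d) : Prop where
  lipschitz : ∃ K, LipschitzWith K x
  mem : ∀ t ∈ Icc 0 T, x t ∈ S
  deriv_mem : ∀ᵐ t, t ∈ Ioo 0 T → -deriv x t ∈ SumField D S G (x t)

theorem IsLipschitzSolution.mono {T T' : ℝ} {x : ℝ → Euc d}
    (hx : IsLipschitzSolution D S G T x) (h : T' ≤ T) : IsLipschitzSolution D S G T' x :=
  ⟨hx.lipschitz, fun t ht => hx.mem t ⟨ht.1, ht.2.trans h⟩, by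
    filter_upwards [hx.deriv_mem] with t ht htT
    exact ht ⟨htT.1, htT.2.trans_le h⟩⟩

theorem HasDerivAt.eq_inner_of_mem_subdiffOn {x : ℝ → Euc d} {t r : ℝ} {u s : Euc d}
    (hG : HasDerivAt (fun τ => G (x τ)) r t) (hx : HasDerivAt x u t)
    (hS : ∀ᶠ τ in 𝓝 t, x τ ∈ S) (hs : s ∈ SubdiffOn S G (x t)) : r = ⟪s, u⟫ := by
  have hmin : IsLocalMin (fun τ => G (x τ) - ⟪s, x τ⟫) t := by
    filter_upwards [hS] with τ hτ
    have := hs.2 _ hτ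
    rw [inner_sub_right] at this
    linarith
  have h1 := (hasDerivAt_const t s).inner ℝ hx
  have h2 := hmin.hasDerivAt_eq_zero (hG.sub h1)
  simp only [inner_zero_left, add_zero] at h2
  linarith

/-- Energy identity for Lipschitz solutions. -/
theorem RealAssumptions.objective_add_integral (h : RealAssumptions f D S G c) {T : ℝ}
    (hT : 0 ≤ T) {x : ℝ → Euc d} (hx : IsLipschitzSolution D S G T x) :
    (∑ i, f i (x T) + G (x T)) + ∫ t in 0..T, ‖deriv x t‖ ^ 2 =
      ∑ i, f i (x 0) + G (x 0) := by
  rcases hT.eq_or_lt with rfl | hT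
  · simp
  obtain ⟨K, hK⟩ := hx.lipschitz
  set φ : ℝ → ℝ := fun t => ∑ i, f i (x t) + G (x t) with hφ
  have hKc : IsCompact (x '' Icc 0 T) := isCompact_Icc.image hK.continuous
  have hKS : x '' Icc 0 T ⊆ S := by
    rintro _ ⟨t, ht, rfl⟩
    exact hx.mem t ht
  have hfL : ∀ F : Euc d → ℝ, LocallyLipschitzOn (x '' Icc 0 T) F →
      AbsolutelyContinuousOnInterval (fun t => F (x t)) 0 T := by
    intro F hF
    obtain ⟨L, hL⟩ := hF.exists_lipschitzOnWith_of_compact hKc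
    refine LipschitzOnWith.absolutelyContinuousOnInterval (K := L * K) ?_
    rw [uIcc_of_le hT.le]
    exact hL.comp hK.lipschitzOnWith (mapsTo_image _ _)
  have hGac := hfL G (h.lipschitzOn.mono hKS)
  have hφac : AbsolutelyContinuousOnInterval φ 0 T := by
    refine hfL (fun p => ∑ i, f i p + G p) (LocallyLipschitzOn.add ?_ (h.lipschitzOn.mono hKS))
    have : LocallyLipschitz fun p => ∑ i, f i p := by
      have hsum : LocallyLipschitz (∑ i, f i) := Finset.sum_induction f LocallyLipschitz
        (fun _ _ => LocallyLipschitz.add) (LocallyLipschitz.const 0) fun i _ => h.lipschitz i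
      simpa only [Finset.sum_fn] using hsum
    exact this.locallyLipschitzOn
  have hder : ∀ᵐ t, t ∈ uIoc 0 T → deriv φ t = -‖deriv x t‖ ^ 2 := by
    have hcons : ∀ᵐ t, ∀ i, t ∈ Ioo 0 T → ∀ v ∈ D i (x t),
        HasDerivAt (fun s => f i (x s)) ⟪v, deriv x t⟫ t :=
      ae_all_iff.2 fun i => (h.conservative i).ae_hasDerivAt (h.nonempty i) hK hT
    have hTne : ∀ᵐ t : ℝ, t ≠ T := by simp [ae_iff]
    filter_upwards [hcons, hGac.ae_differentiableAt, hK.ae_differentiableAt_real, hx.deriv_mem,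
      hTne] with t h1 h2 h3 h4 h5 ht
    rw [uIoc_of_le hT.le] at ht
    have ht' : t ∈ Ioo 0 T := ⟨ht.1, lt_of_le_of_ne ht.2 h5⟩
    obtain ⟨v, hv, s, hs, hvs⟩ := h4 ht'
    have hGd := (h2 (by rw [uIcc_of_le hT.le]; exact Ioo_subset_Icc_self ht')).hasDerivAt
    have hSn : ∀ᶠ τ in 𝓝 t, x τ ∈ S := by
      filter_upwards [Ioo_mem_nhds ht'.1 ht'.2] with τ hτ
      exact hx.mem τ (Ioo_subset_Icc_self hτ)
    have hGe := hGd.eq_inner_of_mem_subdiffOn h3.hasDerivAt hSn hs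
    have := (HasDerivAt.fun_sum fun i (_ : i ∈ Finset.univ) => h1 i ht' (v i) (hv i)).add hGd
    rw [hGe, ← sum_inner, ← inner_add_left, ← hvs, inner_neg_left,
      real_inner_self_eq_norm_sq] at this
    exact this.deriv
  have hint := hφac.integral_deriv_eq_sub
  rw [intervalIntegral.integral_congr_ae hder, intervalIntegral.integral_neg] at hint
  simp only [hφ] at hint
  linarith

theorem LipschitzWith.intervalIntegrable_norm_deriv_sq {x : ℝ → Euc d} {K : NNReal}
    (hx : LipschitzWith K x) (a b : ℝ) :
    IntervalIntegrable (fun t => ‖deriv x t‖ ^ 2) volume a b := by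
  refine (intervalIntegrable_const (c := (K : ℝ) ^ 2)).mono_fun
    ((stronglyMeasurable_deriv x).norm.pow 2).aestronglyMeasurable (Eventually.of_forall fun t => ?_)
  change ‖‖deriv x t‖ ^ 2‖ ≤ ‖(K : ℝ) ^ 2‖
  rw [norm_pow, norm_pow, norm_norm, Real.norm_eq_abs, NNReal.abs_eq]
  exact pow_le_pow_left₀ (norm_nonneg _) (norm_deriv_le_of_lipschitz hx) 2

end Energy

section Limit

theorem Convex.inv_smul_sub_mem_of_steps {E : Type*} [AddCommGroup E] [Module ℝ E] {H : Set E}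
    (hH : Convex ℝ H) {α : ℕ → ℝ} {X : ℕ → E} {k₁ k₂ : ℕ} (hk : k₁ ≤ k₂)
    (hα : ∀ k ∈ Finset.Ico k₁ k₂, 0 < α k)
    (hX : ∀ k ∈ Finset.Ico k₁ k₂, (α k)⁻¹ • (X k - X (k + 1)) ∈ H)
    (hpos : 0 < ∑ k ∈ Finset.range k₂, α k - ∑ k ∈ Finset.range k₁, α k) :
    (∑ k ∈ Finset.range k₂, α k - ∑ k ∈ Finset.range k₁, α k)⁻¹ • (X k₁ - X k₂) ∈ H := by
  rw [← Finset.sum_Ico_eq_sub _ hk] at hpos ⊢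
  have h := hH.centerMass_mem (fun k hk => (hα k hk).le) hpos hX
  have hsum : ∑ k ∈ Finset.Ico k₁ k₂, α k • (α k)⁻¹ • (X k - X (k + 1)) = X k₁ - X k₂ := by
    rw [Finset.sum_congr rfl fun k hk => smul_inv_smul₀ (hα k hk).ne' _,
      Finset.sum_Ico_eq_sub _ hk, Finset.sum_range_sub', Finset.sum_range_sub']
    abel
  rwa [Finset.centerMass, hsum] at h

variable {d N : ℕ} {f : Fin N → Euc d → ℝ} {D : Fin N → Euc d → Set (Euc d)} {S : Set (Euc d)}
  {G : Euc d → ℝ} {c : ℝ}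

/-- One forward-backward step of size `a` from `x` to `x'`, the forward fields being evaluated at
points within `C * a` of `x`, and with velocity bounded by `C`. -/
def IsApproxStep (D : Fin N → Euc d → Set (Euc d)) (S : Set (Euc d)) (G : Euc d → ℝ) (C a : ℝ)
    (x x' : Euc d) : Prop :=
  ∃ (p v : Fin N → Euc d) (s : Euc d), (∀ i, ‖p i - x‖ ≤ C * a) ∧ (∀ i, v i ∈ D i (p i)) ∧
    s ∈ SubdiffOn S G x' ∧ ‖∑ i, v i + s‖ ≤ C ∧ x' = x - a • (∑ i, v i + s)

theorem IsApproxStep.norm_sub_le {C a : ℝ} {x x' : Euc d} (h : IsApproxStep D S G C a x x')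
    (ha : 0 ≤ a) : ‖x' - x‖ ≤ C * a := by
  obtain ⟨p, v, s, -, -, -, hC, rfl⟩ := h
  rw [sub_sub_cancel_left, norm_neg, norm_smul, Real.norm_of_nonneg ha, mul_comm]
  exact mul_le_mul_of_nonneg_right hC ha

theorem norm_sub_le_of_approxSteps {C : ℝ} {α : ℕ → ℝ} {X : ℕ → Euc d} {m : ℕ}
    (hα : ∀ k < m, 0 < α k)
    (hstep : ∀ k < m, IsApproxStep D S G C (α k) (X k) (X (k + 1))) {i j : ℕ} (hij : i ≤ j)
    (hj : j ≤ m) :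
    ‖X j - X i‖ ≤ C * (∑ k ∈ Finset.range j, α k - ∑ k ∈ Finset.range i, α k) := by
  induction j, hij using Nat.le_induction with
  | base => simp
  | succ j hij ih =>
    have h1 := ih (by omega)
    have h2 := (hstep j (by omega)).norm_sub_le (hα j (by omega)).le
    have h3 := norm_sub_le_norm_sub_add_norm_sub (X (j + 1)) (X j) (X i)
    rw [Finset.sum_range_succ]
    linarith

/-- Limits of sequences generated by approximate steps of vanishing size are solutions. -/
theorem RealAssumptions.exists_isLipschitzSolution_of_tendsto (h : RealAssumptions f D S G c)
    (U : Ultrafilter ℕ) {C τ : ℝ} (hC : 0 ≤ C) (hτ : 0 ≤ τ) {α : ℕ → ℕ → ℝ}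
    {X : ℕ → ℕ → Euc d} {m : ℕ → ℕ} {a : ℕ → ℝ} {x₀ : Euc d} (ha : Tendsto a U (𝓝 0))
    (hα : ∀ n, ∀ k < m n, 0 < α n k ∧ α n k ≤ a n)
    (hm : Tendsto (fun n => ∑ k ∈ Finset.range (m n), α n k) U (𝓝 τ))
    (hX0 : ∀ n, X n 0 = x₀) (hXS : ∀ n, ∀ k ≤ m n, X n k ∈ S)
    (hstep : ∀ n, ∀ k < m n, IsApproxStep D S G C (α n k) (X n k) (X n (k + 1))) :
    ∃ y : ℝ → Euc d, IsLipschitzSolution D S G τ y ∧ y 0 = x₀ ∧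
      Tendsto (fun n => X n (m n)) U (𝓝 (y τ)) := by
  set t : ℕ → ℕ → ℝ := fun n j => ∑ k ∈ Finset.range j, α n k with ht
  set κ : ℕ → ℝ → ℕ := fun n r => sInf {k | r ≤ t n k ∨ m n ≤ k} with hκ
  have hκne : ∀ n r, {k | r ≤ t n k ∨ m n ≤ k}.Nonempty := fun n r => ⟨m n, Or.inr le_rfl⟩
  have hκle : ∀ n r, κ n r ≤ m n := fun n r => Nat.sInf_le (Or.inr le_rfl)
  have hκmono : ∀ n {r r' : ℝ}, r ≤ r' → κ n r ≤ κ n r' := fun n r r' hr =>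
    Nat.sInf_le ((Nat.sInf_mem (hκne n r')).imp_left hr.trans)
  have hlow : ∀ n r, min r (t n (m n)) ≤ t n (κ n r) := by
    intro n r
    rcases Nat.sInf_mem (hκne n r) with hr | hr
    · exact (min_le_left _ _).trans hr
    · rw [(hκle n r).antisymm hr]
      exact min_le_right _ _
  have hup : ∀ n r, 0 ≤ r → t n (κ n r) ≤ r + |a n| := by
    intro n r hr
    rcases hk : κ n r with _ | k
    · simp only [ht, Finset.range_zero, Finset.sum_empty]
      positivity
    · have hnot : k ∉ {k | r ≤ t n k ∨ m n ≤ k} := Nat.notMem_of_lt_sInf (by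
        change k < κ n r
        omega)
      simp only [mem_ofPred_eq, not_or, not_le] at hnot
      have h1 := (hα n k hnot.2).2.trans (le_abs_self _)
      have h2 : t n (k + 1) = t n k + α n k := Finset.sum_range_succ _ _
      linarith
  have hlipd : ∀ n {i j : ℕ}, i ≤ j → j ≤ m n → ‖X n j - X n i‖ ≤ C * (t n j - t n i) :=
    fun n i j hij hj => norm_sub_le_of_approxSteps (fun k hk => (hα n k hk).1) (hstep n) hij hj
  have htκ : ∀ r ∈ Icc 0 τ, Tendsto (fun n => t n (κ n r)) U (𝓝 r) := by
    intro r hr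
    refine tendsto_of_tendsto_of_tendsto_of_le_of_le ?_ ?_ (fun n => hlow n r)
      (fun n => hup n r hr.1)
    · simpa [hr.2] using (tendsto_const_nhds (x := r)).min hm
    · simpa using (tendsto_const_nhds (x := r)).add ha.abs
  have hexists : ∀ r, ∃ z, Tendsto (fun n => X n (κ n r)) U (𝓝 z) := by
    intro r
    refine U.exists_tendsto_of_eventually_norm_le (R := ‖x₀‖ + C * (τ + 1)) ?_
    filter_upwards [hm.eventually (gt_mem_nhds (lt_add_one τ))] with n hn
    have h1 := hlipd n (Nat.zero_le _) (hκle n r)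
    have h2 : t n (κ n r) ≤ t n (m n) := Finset.sum_le_sum_of_subset_of_nonneg
      (Finset.range_subset_range.2 (hκle n r))
      fun k hk _ => (hα n k (Finset.mem_range.1 hk)).1.le
    have h3 : t n 0 = 0 := by simp [ht]
    have h4 : C * (t n (κ n r) - t n 0) ≤ C * (τ + 1) :=
      mul_le_mul_of_nonneg_left (by rw [h3]; linarith) hC
    have h5 := norm_le_norm_add_norm_sub' (X n (κ n r)) (X n 0)
    rw [hX0] at h1 h5
    linarith
  choose z hz using hexists
  have hzlip : ∀ r ∈ Icc 0 τ, ∀ r' ∈ Icc 0 τ, r ≤ r' → ‖z r' - z r‖ ≤ C * (r' - r) := by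
    intro r hr r' hr' hrr
    exact le_of_tendsto_of_tendsto ((hz r').sub (hz r)).norm
      (((htκ r' hr').sub (htκ r hr)).const_mul C)
      (Eventually.of_forall fun n => hlipd n (hκmono n hrr) (hκle n r'))
  have hzL : LipschitzOnWith ⟨C, hC⟩ z (Icc 0 τ) := by
    refine LipschitzOnWith.of_dist_le_mul fun r hr r' hr' => ?_
    rw [dist_eq_norm, Real.dist_eq]
    change _ ≤ C * _
    rcases le_total r r' with hrr | hrr
    · rw [norm_sub_rev, abs_sub_comm, abs_of_nonneg (sub_nonneg.2 hrr)]
      exact hzlip r hr r' hr' hrr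
    · rw [abs_of_nonneg (sub_nonneg.2 hrr)]
      exact hzlip r' hr' r hr hrr
  set y : ℝ → Euc d := IccExtend hτ fun r => z r with hy
  have hyz : ∀ r ∈ Icc 0 τ, y r = z r := fun r hr => IccExtend_of_mem hτ _ hr
  have hyL : LipschitzWith (⟨C, hC⟩ * 1) y :=
    (lipschitzOnWith_iff_restrict.1 hzL).comp (LipschitzWith.projIcc hτ)
  have hzero : y 0 = x₀ := by
    rw [hyz 0 ⟨le_rfl, hτ⟩]
    refine tendsto_nhds_unique (hz 0) (tendsto_const_nhds.congr fun n => ?_)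
    have : κ n 0 = 0 := Nat.le_zero.1 (Nat.sInf_le (Or.inl (by simp [ht])))
    rw [this, hX0]
  refine ⟨y, ⟨⟨_, hyL⟩, fun r hr => ?_, ?_⟩, hzero, ?_⟩
  · rw [hyz r hr]
    exact h.isClosed.mem_of_tendsto (hz r) (Eventually.of_forall fun n => hXS n _ (hκle n r))
  · filter_upwards [hyL.ae_differentiableAt_real] with r hdiff hr
    have hrI : r ∈ Icc 0 τ := Ioo_subset_Icc_self hr
    rw [← (h.isClosed_sumField (y r)).closure_eq, Metric.closure_eq_iInter_cthickening]
    refine mem_iInter₂.2 fun η hη => ?_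
    obtain ⟨δ, hδ, hH⟩ := h.exists_mem_cthickening (y r) C hη
    set H := Metric.cthickening η (SumField D S G (y r))
    have hHconv : Convex ℝ H := (h.convex_sumField (y r)).cthickening η
    have hslope := hdiff.hasDerivAt.tendsto_slope_zero_right.neg
    refine Metric.isClosed_cthickening.mem_of_tendsto hslope ?_
    have hsmall : ∀ᶠ b : ℝ in 𝓝[>] 0, b < τ - r ∧ C * b < δ / 2 := by
      refine (Filter.Eventually.and ?_ ?_).filter_mono nhdsWithin_le_nhds
      · exact gt_mem_nhds (sub_pos.2 hr.2)
      · have : Tendsto (fun b : ℝ => C * b) (𝓝 0) (𝓝 0) :=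
          Continuous.tendsto' (by fun_prop) _ _ (by simp)
        exact this.eventually (gt_mem_nhds (half_pos hδ))
    filter_upwards [hsmall, self_mem_nhdsWithin] with b hb hb0
    have hb0 : 0 < b := hb0
    have hrb : r + b ∈ Icc 0 τ := ⟨by linarith [hr.1], by linarith [hb.1]⟩
    rw [← smul_neg, neg_sub]
    have hA : Tendsto (fun n => t n (κ n (r + b)) - t n (κ n r)) U (𝓝 b) := by
      simpa using (htκ _ hrb).sub (htκ r hrI)
    have hlim := (hA.inv₀ hb0.ne').smul ((hz r).sub (hz (r + b)))
    rw [← hyz _ hrb, ← hyz r hrI] at hlim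
    refine Metric.isClosed_cthickening.mem_of_tendsto hlim ?_
    have hXr : ∀ᶠ n in U, ‖X n (κ n r) - y r‖ < δ / 4 := by
      rw [hyz r hrI]
      exact (tendsto_iff_norm_sub_tendsto_zero.1 (hz r)).eventually (gt_mem_nhds (by positivity))
    have ha' : ∀ᶠ n in U, C * |a n| < δ / 4 := by
      have : Tendsto (fun n => C * |a n|) U (𝓝 0) := by simpa using ha.abs.const_mul C
      exact this.eventually (gt_mem_nhds (by positivity))
    filter_upwards [hXr, ha', hA.eventually (lt_mem_nhds hb0),
      (hA.const_mul C).eventually (gt_mem_nhds hb.2)] with n hn1 hn2 hn3 hn4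
    have hkk : κ n r ≤ κ n (r + b) := hκmono n (by linarith)
    have hkm := hκle n (r + b)
    have hnear : ∀ k, κ n r ≤ k → k ≤ κ n (r + b) → ‖X n k - y r‖ ≤ 3 * δ / 4 := by
      intro k hk1 hk2
      have h1 := hlipd n hk1 (hk2.trans hkm)
      have h2 : t n k ≤ t n (κ n (r + b)) := Finset.sum_le_sum_of_subset_of_nonneg
        (Finset.range_subset_range.2 hk2)
        fun j hj _ => (hα n j ((Finset.mem_range.1 hj).trans_le hkm)).1.le
      have h3 : C * (t n k - t n (κ n r)) ≤ C * (t n (κ n (r + b)) - t n (κ n r)) :=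
        mul_le_mul_of_nonneg_left (by linarith) hC
      have h4 := norm_sub_le_norm_sub_add_norm_sub (X n k) (X n (κ n r)) (y r)
      linarith
    refine hHconv.inv_smul_sub_mem_of_steps hkk
      (fun k hk => (hα n k ((Finset.mem_Ico.1 hk).2.trans_le hkm)).1) (fun k hk => ?_) hn3
    obtain ⟨hk1, hk2⟩ := Finset.mem_Ico.1 hk
    obtain ⟨hα0, hαa⟩ := hα n k (hk2.trans_le hkm)
    obtain ⟨p, v, s, hp, hv, hs, hvC, hXk⟩ := hstep n k (hk2.trans_le hkm)
    have hvel : (α n k)⁻¹ • (X n k - X n (k + 1)) = ∑ i, v i + s := by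
      rw [hXk, sub_sub_cancel, inv_smul_smul₀ hα0.ne']
    rw [hvel]
    refine hH p (X n (k + 1)) v s (fun i => ?_) ?_ hv hs hvC
    · have h1 := norm_sub_le_norm_sub_add_norm_sub (p i) (X n k) (y r)
      have h2 := hnear k hk1 hk2.le
      have h3 : C * α n k ≤ C * |a n| :=
        mul_le_mul_of_nonneg_left (hαa.trans (le_abs_self _)) hC
      linarith [hp i]
    · linarith [hnear (k + 1) (by omega) (by omega)]
  · rw [hyz τ ⟨hτ, le_rfl⟩]
    have h1 : Tendsto (fun n => X n (m n) - X n (κ n τ)) U (𝓝 0) := by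
      refine squeeze_zero_norm (fun n => hlipd n (hκle n τ) le_rfl) ?_
      simpa using (hm.sub (htκ τ ⟨hτ, le_rfl⟩)).const_mul C
    simpa using h1.add (hz τ)

end Limit

section Existence

variable {d N : ℕ} {f : Fin N → Euc d → ℝ} {D : Fin N → Euc d → Set (Euc d)} {S : Set (Euc d)}
  {G : Euc d → ℝ} {c : ℝ}

theorem ConvexOn.inv_smul_sub_mem_subdiffOn (hG : ConvexOn ℝ S G) {a : ℝ} (ha : 0 < a)
    {z q : Euc d} (hq : q ∈ S)
    (hmin : ∀ w ∈ S, G q + ‖q - z‖ ^ 2 / (2 * a) ≤ G w + ‖w - z‖ ^ 2 / (2 * a)) :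
    a⁻¹ • (z - q) ∈ SubdiffOn S G q := by
  refine ⟨hq, fun y hy => ?_⟩
  have key : ∀ θ ∈ Ioo (0 : ℝ) 1,
      G q + ⟪a⁻¹ • (z - q), y - q⟫ ≤ G y + θ * (‖y - q‖ ^ 2 / (2 * a)) := by
    rintro θ ⟨h0, h1⟩
    have hw := hG.1 hq hy (sub_nonneg.2 h1.le) h0.le (by ring)
    have hGw := hG.2 hq hy (sub_nonneg.2 h1.le) h0.le (by ring)
    have hm := hmin _ hw
    have hrw : (1 - θ) • q + θ • y - z = (q - z) + θ • (y - q) := by module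
    rw [hrw, norm_add_sq_real, real_inner_smul_right, norm_smul, mul_pow, Real.norm_eq_abs,
      sq_abs] at hm
    have hneg : ⟪z - q, y - q⟫ = -⟪q - z, y - q⟫ := by
      rw [← inner_neg_left, neg_sub]
    rw [real_inner_smul_left, hneg]
    simp only [smul_eq_mul] at hGw
    have hdiv : (‖q - z‖ ^ 2 + 2 * (θ * ⟪q - z, y - q⟫) + θ ^ 2 * ‖y - q‖ ^ 2) / (2 * a) =
        ‖q - z‖ ^ 2 / (2 * a) + θ * (a⁻¹ * ⟪q - z, y - q⟫ + θ * (‖y - q‖ ^ 2 / (2 * a))) := by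
      field_simp
      ring
    rw [hdiv] at hm
    refine le_of_mul_le_mul_left ?_ h0
    linarith
  have hlim : Tendsto (fun θ : ℝ => G y + θ * (‖y - q‖ ^ 2 / (2 * a))) (𝓝[>] 0) (𝓝 (G y)) :=
    (Continuous.tendsto' (by fun_prop) _ _ (by simp)).mono_left nhdsWithin_le_nhds
  refine ge_of_tendsto hlim ?_
  filter_upwards [Ioo_mem_nhdsGT one_pos] with θ hθ using key θ hθ

theorem ConvexOn.isApproxStep_of_isMin (hG : ConvexOn ℝ S G) {L K a : ℝ} (ha : 0 < a)
    (hC : 0 ≤ N * L + K) {x q : Euc d} (hx : x ∈ S) (hq : q ∈ S) {p v : Fin N → Euc d}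
    (hp : ∀ i, ‖p i - x‖ ≤ (N * L + K) * a) (hv : ∀ i, v i ∈ D i (p i)) (hvL : ∀ i, ‖v i‖ ≤ L)
    (hK : G x - G q ≤ K * ‖x - q‖)
    (hmin : ∀ w ∈ S, G q + ‖q - (x - a • ∑ i, v i)‖ ^ 2 / (2 * a) ≤
      G w + ‖w - (x - a • ∑ i, v i)‖ ^ 2 / (2 * a)) :
    IsApproxStep D S G (N * L + K) a x q := by
  have hs := hG.inv_smul_sub_mem_subdiffOn ha hq hmin
  set s := a⁻¹ • (x - a • ∑ i, v i - q) with hsdef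
  have hvel : a • (∑ i, v i + s) = x - q := by
    rw [smul_add, hsdef, smul_inv_smul₀ ha.ne']
    abel
  have hw : ‖∑ i, v i‖ ≤ N * L := by
    refine (norm_sum_le_of_le _ fun i _ => hvL i).trans ?_
    simp
  refine ⟨p, v, s, hp, hv, hs, ?_, by rw [hvel, sub_sub_cancel]⟩
  set g := ∑ i, v i + s with hg
  have hsub := hs.2 x hx
  have hseq : s = g - ∑ i, v i := by rw [hg]; abel
  rw [← hvel, real_inner_smul_right, hseq, inner_sub_left, real_inner_self_eq_norm_sq] at hsub
  rw [← hvel, norm_smul, Real.norm_of_nonneg ha.le] at hK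
  have hcs := (real_inner_le_norm (∑ i, v i) g).trans
    (mul_le_mul_of_nonneg_right hw (norm_nonneg g))
  have h1 : a * (‖g‖ * ‖g‖) ≤ a * ((N * L + K) * ‖g‖) := by
    have := mul_le_mul_of_nonneg_left hcs ha.le
    nlinarith
  have h2 := le_of_mul_le_mul_left h1 ha
  rcases (norm_nonneg g).eq_or_lt with h0 | h0
  · rwa [← h0]
  · exact le_of_mul_le_mul_right h2 h0

theorem RealAssumptions.inter_closedBall (h : RealAssumptions f D S G c) (R : ℝ) :
    RealAssumptions f D (S ∩ Metric.closedBall 0 R) G c where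
  lipschitz := h.lipschitz
  conservative := h.conservative
  locBounded := h.locBounded
  nonempty := h.nonempty
  convex := h.convex
  isClosed := h.isClosed.inter Metric.isClosed_closedBall
  convexOn := h.convexOn.subset inter_subset_left (h.convexOn.1.inter (convex_closedBall 0 R))
  lipschitzOn := h.lipschitzOn.mono inter_subset_left
  le_objective := fun x hx => h.le_objective x hx.1

theorem ConvexOn.subdiffOn_of_inter_closedBall (hG : ConvexOn ℝ S G) {R : ℝ} {x s : Euc d}
    (hx : ‖x‖ < R) (hs : s ∈ SubdiffOn (S ∩ Metric.closedBall 0 R) G x) :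
    s ∈ SubdiffOn S G x := by
  refine ⟨hs.1.1, fun y hy => ?_⟩
  have hlim : Tendsto (fun θ : ℝ => (1 - θ) • x + θ • y) (𝓝[>] 0) (𝓝 x) :=
    (Continuous.tendsto' (by fun_prop) _ _ (by simp)).mono_left nhdsWithin_le_nhds
  obtain ⟨θ, hθR, h0, h1⟩ := ((hlim.norm.eventually (gt_mem_nhds hx)).and
    (Ioo_mem_nhdsGT one_pos)).exists
  have hw := hG.1 hs.1.1 hy (sub_nonneg.2 h1.le) h0.le (by ring)
  have hGw := hG.2 hs.1.1 hy (sub_nonneg.2 h1.le) h0.le (by ring)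
  have hm := hs.2 _ ⟨hw, by simpa using hθR.le⟩
  have hrw : (1 - θ) • x + θ • y - x = θ • (y - x) := by module
  rw [hrw, real_inner_smul_right] at hm
  simp only [smul_eq_mul] at hGw
  refine le_of_mul_le_mul_left ?_ h0
  linarith

/-- On a bounded domain the forward-backward scheme is well defined. -/
theorem RealAssumptions.exists_isApproxStep (h : RealAssumptions f D S G c) (hS : IsCompact S) :
    ∃ C : ℝ, 0 ≤ C ∧ ∀ a > 0, ∀ x ∈ S, ∃ q ∈ S, IsApproxStep D S G C a x q := by
  obtain ⟨L, hL0, hL⟩ := exists_norm_le_of_locBounded_family h.locBounded hS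
  obtain ⟨K, hK⟩ := h.lipschitzOn.exists_lipschitzOnWith_of_compact hS
  refine ⟨N * L + K, by positivity, fun a ha x hx => ?_⟩
  choose v hv using fun i => h.nonempty i x
  have hcont : ContinuousOn (fun w => G w + ‖w - (x - a • ∑ i, v i)‖ ^ 2 / (2 * a)) S :=
    h.lipschitzOn.continuousOn.add (by fun_prop)
  obtain ⟨q, hq, hmin⟩ := hS.exists_isMinOn ⟨x, hx⟩ hcont
  refine ⟨q, hq, h.convexOn.isApproxStep_of_isMin ha (by positivity) hx hq (p := fun _ => x)
    (fun i => ?_) hv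
    (fun i => hL i x hx _ (hv i)) ?_ fun w hw => hmin hw⟩
  · rw [sub_self, norm_zero]
    positivity
  · have := hK.dist_le_mul x hx q hq
    rw [Real.dist_eq, dist_eq_norm] at this
    exact (le_abs_self _).trans this

theorem RealAssumptions.exists_solution_of_isCompact (h : RealAssumptions f D S G c)
    (hS : IsCompact S) {x₁ : Euc d} (hx₁ : x₁ ∈ S) {T : ℝ} (hT : 0 < T) :
    ∃ y, IsLipschitzSolution D S G T y ∧ y 0 = x₁ := by
  obtain ⟨C, hC, hnext⟩ := h.exists_isApproxStep hS
  choose q hqS hq using hnext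
  have hpos : ∀ n : ℕ, 0 < T / ((n : ℝ) + 1) := fun n => by positivity
  set X : ℕ → ℕ → S := fun n k => Nat.rec (motive := fun _ => S) ⟨x₁, hx₁⟩
    (fun _ x => ⟨q _ (hpos n) x x.2, hqS _ _ _ _⟩) k with hX
  have hU : (hyperfilter ℕ : Filter ℕ) ≤ atTop := Nat.hyperfilter_le_atTop
  obtain ⟨y, hy, hy0, -⟩ := h.exists_isLipschitzSolution_of_tendsto (hyperfilter ℕ) hC hT.le
    (α := fun n _ => T / ((n : ℝ) + 1)) (X := fun n k => X n k) (m := fun n => n + 1)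
    (a := fun n => T / ((n : ℝ) + 1)) (x₀ := x₁)
    (by simpa [div_eq_mul_inv] using
      ((tendsto_one_div_add_atTop_nhds_zero_nat (𝕜 := ℝ)).const_mul T).mono_left hU)
    (fun n k _ => ⟨hpos n, le_rfl⟩)
    (tendsto_const_nhds.congr fun n => by
      rw [Finset.sum_const, Finset.card_range, nsmul_eq_mul]
      push_cast
      field_simp)
    (fun n => rfl) (fun n k _ => (X n k).2) (fun n k _ => hq _ _ _ _)
  exact ⟨y, hy, hy0⟩

/-- Existence of Lipschitz solutions on every bounded interval. -/
theorem RealAssumptions.exists_solution (h : RealAssumptions f D S G c) {x₁ : Euc d}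
    (hx₁ : x₁ ∈ S) {T : ℝ} (hT : 0 < T) :
    ∃ y, IsLipschitzSolution D S G T y ∧ y 0 = x₁ := by
  set B : ℝ := T + (∑ i, f i x₁ + G x₁ - c) with hB
  have hB0 : 0 ≤ B := by linarith [h.le_objective x₁ hx₁]
  set R : ℝ := ‖x₁‖ + B + 1 with hR
  have hR' := h.inter_closedBall R
  obtain ⟨y, hy, hy0⟩ := hR'.exists_solution_of_isCompact
    ((isCompact_closedBall 0 R).inter_left h.isClosed)
    (x₁ := x₁) ⟨hx₁, by rw [mem_closedBall_zero_iff]; linarith⟩ hT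
  refine ⟨y, ⟨hy.lipschitz, fun t ht => (hy.mem t ht).1, ?_⟩, hy0⟩
  obtain ⟨K, hK⟩ := hy.lipschitz
  have hbound : ∀ t ∈ Icc 0 T, ‖y t‖ < R := by
    intro t ht
    have hen := hR'.objective_add_integral ht.1 (hy.mono ht.2)
    have hlow := h.le_objective _ (hy.mem t ht).1
    have hdiff : ‖y t - y 0‖ ≤ ∫ s in 0..t, (1 + ‖deriv y s‖ ^ 2) := by
      rw [← hK.integral_deriv_eq_sub]
      refine intervalIntegral.norm_integral_le_of_norm_le ht.1
        (Eventually.of_forall fun s _ => ?_)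
        (intervalIntegrable_const.add (hK.intervalIntegrable_norm_deriv_sq 0 t))
      nlinarith [sq_nonneg (‖deriv y s‖ - 1)]
    rw [intervalIntegral.integral_add intervalIntegrable_const
      (hK.intervalIntegrable_norm_deriv_sq 0 t)] at hdiff
    simp only [intervalIntegral.integral_const, sub_zero, smul_eq_mul, mul_one] at hdiff
    have h3 := norm_le_norm_add_norm_sub' (y t) (y 0)
    rw [hy0] at hen h3 hdiff
    linarith [ht.2]
  filter_upwards [hy.deriv_mem] with t ht htT
  obtain ⟨v, hv, s, hs, hvs⟩ := ht htT
  exact ⟨v, hv, s,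
    h.convexOn.subdiffOn_of_inter_closedBall (hbound t (Ioo_subset_Icc_self htT)) hs, hvs⟩

end Existence

section Uniqueness

variable {d N : ℕ} {f : Fin N → Euc d → ℝ} {D : Fin N → Euc d → Set (Euc d)} {S : Set (Euc d)}
  {G : Euc d → ℝ} {c : ℝ}

/-- Every Lipschitz solution on `[0, T]` extends to a global solution. -/
theorem RealAssumptions.exists_extension (h : RealAssumptions f D S G c) {T : ℝ} (hT : 0 < T)
    {y : ℝ → Euc d} (hy : IsLipschitzSolution D S G T y) :
    ∃ x u : ℝ → Euc d, (∀ T' ≥ (0 : ℝ), IntervalIntegrable u volume 0 T') ∧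
      (∀ t ≥ (0 : ℝ), x t = x 0 + ∫ s in (0 : ℝ)..t, u s) ∧
      (∀ᵐ t ∂volume, 0 < t → -u t ∈ SumField D S G (x t)) ∧ ∀ t ∈ Icc 0 T, x t = y t := by
  have hnext : ∀ z : {z // IsLipschitzSolution D S G T z},
      ∃ w : {w // IsLipschitzSolution D S G T w}, w.1 0 = z.1 T := fun z => by
    obtain ⟨w, hw, hw0⟩ := h.exists_solution (z.2.mem T ⟨hT.le, le_rfl⟩) hT
    exact ⟨⟨w, hw⟩, hw0⟩
  choose next hnext using hnext
  set P : ℕ → {z // IsLipschitzSolution D S G T z} :=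
    fun n => Nat.rec ⟨y, hy⟩ (fun _ z => next z) n with hP
  have hlink : ∀ n, (P (n + 1)).1 0 = (P n).1 T := fun n => hnext (P n)
  set ι : ℝ → ℕ := fun t => ⌈t / T⌉₊ - 1 with hι
  have hιn : ∀ (n : ℕ) (t : ℝ), t ∈ Ioc (n * T) ((n + 1) * T) → ι t = n := by
    intro n t ht
    have : ⌈t / T⌉₊ = n + 1 := by
      rw [Nat.ceil_eq_iff (Nat.succ_ne_zero n)]
      push_cast
      exact ⟨by rw [lt_div_iff₀ hT]; exact ht.1, by
        rw [div_le_iff₀ hT]; exact ht.2⟩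
    simp [hι, this]
  have hcover : ∀ t : ℝ, 0 < t → ∃ n : ℕ, t ∈ Ioc (n * T) ((n + 1) * T) := by
    intro t ht
    have hc : 0 < ⌈t / T⌉₊ := Nat.ceil_pos.2 (div_pos ht hT)
    obtain ⟨n, hn⟩ := Nat.exists_eq_succ_of_ne_zero hc.ne'
    rw [Nat.succ_eq_add_one, Nat.ceil_eq_iff (Nat.succ_ne_zero n)] at hn
    push_cast at hn
    rw [lt_div_iff₀ hT, div_le_iff₀ hT] at hn
    exact ⟨n, hn⟩
  set x : ℝ → Euc d := fun t => (P (ι t)).1 (t - ι t * T) with hx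
  set u : ℝ → Euc d := fun t => deriv (P (ι t)).1 (t - ι t * T) with hu
  have hxn : ∀ (n : ℕ) (t : ℝ), t ∈ Icc (n * T) ((n + 1) * T) → x t = (P n).1 (t - n * T) := by
    intro n t ht
    rcases ht.1.eq_or_lt with heq | hlt
    · rcases n with _ | n
      · have : t = 0 := by simpa using heq.symm
        simp [hx, hι, this]
      · have hmem : t ∈ Ioc (n * T) ((n + 1) * T) := by
          push_cast at heq
          exact ⟨by nlinarith, heq.symm.le⟩
        simp only [hx, hιn n t hmem]
        have h1 : t - n * T = T := by rw [← heq]; push_cast; ring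
        have h2 : t - ((n + 1 : ℕ) : ℝ) * T = 0 := by rw [heq, sub_self]
        rw [h1, h2, hlink]
    · simp only [hx, hιn n t ⟨hlt, ht.2⟩]
  have hun : ∀ (n : ℕ) (t : ℝ), t ∈ Ioc (n * T) ((n + 1) * T) →
      u t = deriv (P n).1 (t - n * T) := by
    intro n t ht
    simp only [hu, hιn n t ht]
  have hpiece : ∀ (n : ℕ) (t : ℝ), t ∈ Icc (n * T) ((n + 1) * T) →
      IntervalIntegrable u volume (n * T) t ∧ x t = x (n * T) + ∫ s in (n * T)..t, u s := by
    intro n t ht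
    obtain ⟨K, hK⟩ := (P n).2.lipschitz
    have heq : EqOn (fun s => deriv (P n).1 (s - n * T)) u (uIoc (n * T) t) := by
      intro s hs
      rw [uIoc_of_le ht.1] at hs
      exact (hun n s ⟨hs.1, hs.2.trans ht.2⟩).symm
    have hint : IntervalIntegrable (fun s => deriv (P n).1 (s - n * T)) volume (n * T) t := by
      have := (hK.intervalIntegrable_deriv 0 (t - n * T)).comp_sub_right (n * T)
      simpa using this
    refine ⟨hint.congr heq, ?_⟩
    rw [hxn n t ht, hxn n _ ⟨le_rfl, by nlinarith⟩,
      ← intervalIntegral.integral_congr_ae (Eventually.of_forall heq),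
      intervalIntegral.integral_comp_sub_right (fun s => deriv (P n).1 s),
      hK.integral_deriv_eq_sub]
    abel
  have hstart : ∀ n : ℕ, IntervalIntegrable u volume 0 (n * T) ∧
      x (n * T) = x 0 + ∫ s in (0 : ℝ)..(n * T), u s := by
    intro n
    induction n with
    | zero => simp
    | succ n ih =>
      have h1 := hpiece n ((n + 1) * T) ⟨by nlinarith, le_rfl⟩
      push_cast
      refine ⟨ih.1.trans h1.1, ?_⟩
      rw [h1.2, ih.2, ← intervalIntegral.integral_add_adjacent_intervals ih.1 h1.1, add_assoc]
  have hall : ∀ t ≥ (0 : ℝ), IntervalIntegrable u volume 0 t ∧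
      x t = x 0 + ∫ s in (0 : ℝ)..t, u s := by
    intro t ht
    rcases ht.eq_or_lt with rfl | ht
    · simp
    · obtain ⟨n, hn⟩ := hcover t ht
      have h1 := hpiece n t (Ioc_subset_Icc_self hn)
      refine ⟨(hstart n).1.trans h1.1, ?_⟩
      rw [h1.2, (hstart n).2,
        ← intervalIntegral.integral_add_adjacent_intervals (hstart n).1 h1.1, add_assoc]
  refine ⟨x, u, fun t ht => (hall t ht).1, fun t ht => (hall t ht).2, ?_, fun t ht => ?_⟩
  · have hae : ∀ᵐ t : ℝ, ∀ n : ℕ, t - n * T ∈ Ioo 0 T →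
        -deriv (P n).1 (t - n * T) ∈ SumField D S G ((P n).1 (t - n * T)) :=
      ae_all_iff.2 fun n =>
        (measurePreserving_sub_right volume (n * T)).quasiMeasurePreserving.ae (P n).2.deriv_mem
    have hne : ∀ᵐ t : ℝ, ∀ n : ℕ, t ≠ (n + 1) * T :=
      ae_all_iff.2 fun n => by simp [ae_iff]
    filter_upwards [hae, hne] with t h1 h2 ht
    obtain ⟨n, hn⟩ := hcover t ht
    have hlt : t < (n + 1) * T := lt_of_le_of_ne hn.2 (h2 n)
    rw [hun n t hn, hxn n t (Ioc_subset_Icc_self hn)]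
    exact h1 n ⟨by linarith [hn.1], by linarith⟩
  · have := hxn 0 t (by simpa using ht)
    simpa [hP] using this

/-- A solution over a long time interval has points of small velocity. -/
theorem RealAssumptions.exists_norm_deriv_lt (h : RealAssumptions f D S G c) {T M δ : ℝ}
    (hT : 0 ≤ T) (hM : 0 < M) (hδ : 0 < δ) {y : ℝ → Euc d}
    (hy : IsLipschitzSolution D S G (T + M) y)
    (hlt : ∑ i, f i (y 0) + G (y 0) - c < M * δ ^ 2) :
    ∃ t ∈ Ioo T (T + M), ‖deriv y t‖ < δ ∧ -deriv y t ∈ SumField D S G (y t) := by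
  by_contra! hcon
  obtain ⟨K, hK⟩ := hy.lipschitz
  have hint := fun a b => hK.intervalIntegrable_norm_deriv_sq a b
  have hen := h.objective_add_integral (by positivity) hy
  have hlow := h.le_objective _ (hy.mem (T + M) ⟨by positivity, le_rfl⟩)
  rw [← intervalIntegral.integral_add_adjacent_intervals (hint 0 T) (hint T (T + M))] at hen
  have h1 : 0 ≤ ∫ t in 0..T, ‖deriv y t‖ ^ 2 :=
    intervalIntegral.integral_nonneg hT fun t _ => by positivity
  have h2 : ∫ _ in T..(T + M), δ ^ 2 ≤ ∫ t in T..(T + M), ‖deriv y t‖ ^ 2 := by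
    refine intervalIntegral.integral_mono_ae_restrict (by linarith) intervalIntegrable_const
      (hint _ _) ?_
    rw [← restrict_Ioo_eq_restrict_Icc]
    refine (ae_restrict_iff' measurableSet_Ioo).2 ?_
    filter_upwards [hy.deriv_mem] with t ht htI
    refine pow_le_pow_left₀ hδ.le ?_ 2
    by_contra! hlt'
    exact hcon t htI hlt' (ht ⟨hT.trans_lt htI.1, htI.2⟩)
  simp only [intervalIntegral.integral_const, smul_eq_mul, add_sub_cancel_left] at h2
  linarith

/-- Under uniqueness, approximate steps of small size track the solution on bounded time
intervals. -/
theorem RealAssumptions.exists_step_bound (h : RealAssumptions f D S G c) {x₀ : Euc d}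
    {xt : ℝ → Euc d} (hcont : ContinuousOn xt (Ici 0))
    (huniq : ∀ τ ≥ (0 : ℝ), ∀ y, IsLipschitzSolution D S G τ y → y 0 = x₀ → y τ = xt τ)
    {C : ℝ} (hC : 0 ≤ C) (T : ℝ) {δ : ℝ} (hδ : 0 < δ) :
    ∃ αbar > (0 : ℝ), ∀ (α : ℕ → ℝ) (X : ℕ → Euc d) (m : ℕ), X 0 = x₀ →
      (∀ k < m, 0 < α k ∧ α k ≤ αbar) → (∀ k ≤ m, X k ∈ S) →
      (∀ k < m, IsApproxStep D S G C (α k) (X k) (X (k + 1))) →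
      ∑ k ∈ Finset.range m, α k ≤ T →
      ‖X m - xt (∑ k ∈ Finset.range m, α k)‖ ≤ δ := by
  by_contra! hcon
  choose α X m h0 hα hS hstep hT hfar using fun n : ℕ =>
    hcon (1 / ((n : ℝ) + 1)) Nat.one_div_pos_of_nat
  have hU : (hyperfilter ℕ : Filter ℕ) ≤ atTop := Nat.hyperfilter_le_atTop
  have ha := (tendsto_one_div_add_atTop_nhds_zero_nat (𝕜 := ℝ)).mono_left hU
  have hnn : ∀ n, 0 ≤ ∑ k ∈ Finset.range (m n), α n k := fun n =>
    Finset.sum_nonneg fun k hk => (hα n k (Finset.mem_range.1 hk)).1.le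
  obtain ⟨τ, hτ⟩ := (hyperfilter ℕ).exists_tendsto_of_eventually_norm_le
    (a := fun n => ∑ k ∈ Finset.range (m n), α n k) (R := T)
    (Eventually.of_forall fun n => by rw [Real.norm_of_nonneg (hnn n)]; exact hT n)
  have hτ0 : 0 ≤ τ := ge_of_tendsto hτ (Eventually.of_forall hnn)
  obtain ⟨y, hy, hy0, hlim⟩ := h.exists_isLipschitzSolution_of_tendsto (hyperfilter ℕ) hC hτ0 ha
    hα hτ h0 hS hstep
  rw [huniq τ hτ0 y hy hy0] at hlim
  have hxt : Tendsto (fun n => xt (∑ k ∈ Finset.range (m n), α n k)) (hyperfilter ℕ)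
      (𝓝 (xt τ)) :=
    (hcont τ hτ0).tendsto.comp (tendsto_nhdsWithin_iff.2 ⟨hτ, Eventually.of_forall hnn⟩)
  have hzero := (hlim.sub hxt).norm
  rw [sub_self, norm_zero] at hzero
  obtain ⟨n, hn⟩ := (hzero.eventually (gt_mem_nhds hδ)).exists
  exact (hfar n).not_gt hn

end Uniqueness

section Reshuffling

variable {d N : ℕ} {f : Fin N → Euc d → ℝ} {D : Fin N → Euc d → Set (Euc d)} {S : Set (Euc d)}
  {G : Euc d → ℝ} {c : ℝ}

theorem ConvexOn.sub_le_of_lipschitzOnWith (hG : ConvexOn ℝ S G) {K : NNReal} {R : ℝ}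
    (hK : LipschitzOnWith K G (S ∩ Metric.closedBall 0 (R + 1))) {x q : Euc d} (hx : x ∈ S)
    (hxR : ‖x‖ ≤ R) (hq : q ∈ S) : G x - G q ≤ K * ‖x - q‖ := by
  have hlim : Tendsto (fun θ : ℝ => (1 - θ) • x + θ • q) (𝓝[>] 0) (𝓝 x) :=
    (Continuous.tendsto' (by fun_prop) _ _ (by simp)).mono_left nhdsWithin_le_nhds
  obtain ⟨θ, hθR, h0, h1⟩ := ((hlim.norm.eventually (gt_mem_nhds (hxR.trans_lt
    (lt_add_one R)))).and (Ioo_mem_nhdsGT one_pos)).exists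
  have hw := hG.1 hx hq (sub_nonneg.2 h1.le) h0.le (by ring)
  have hGw := hG.2 hx hq (sub_nonneg.2 h1.le) h0.le (by ring)
  have hL := hK.dist_le_mul x ⟨hx, by rw [mem_closedBall_zero_iff]; linarith⟩ _
    ⟨hw, by simpa using hθR.le⟩
  have hrw : x - ((1 - θ) • x + θ • q) = θ • (x - q) := by module
  rw [dist_eq_norm, dist_eq_norm, hrw, norm_smul, Real.norm_of_nonneg h0.le] at hL
  have hL' := (le_abs_self _).trans hL
  simp only [smul_eq_mul] at hGw
  refine le_of_mul_le_mul_left ?_ h0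
  linarith

theorem Subdiff_eq_subdiffOn {g : Euc d → EReal} (hg : ProperFn g) (x : Euc d) :
    Subdiff g x = SubdiffOn {x | g x ≠ ⊤} (fun x => (g x).toReal) x := by
  obtain ⟨⟨y₀, hy₀⟩, hbot⟩ := hg
  have hcoe : ∀ y, g y ≠ ⊤ → g y = ((g y).toReal : EReal) := fun y hy =>
    (EReal.coe_toReal hy (hbot y)).symm
  ext v
  refine ⟨fun hv => ?_, fun hv y => ?_⟩
  · have hx : g x ≠ ⊤ := by
      intro hx
      have := hv y₀
      rw [hx, EReal.top_add_coe] at this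
      exact hy₀ (top_le_iff.1 this)
    refine ⟨hx, fun y hy => ?_⟩
    have := hv y
    rw [hcoe x hx, hcoe y hy] at this
    exact_mod_cast this
  · by_cases hy : g y = ⊤
    · rw [hy]
      exact le_top
    · have := hv.2 y hy
      rw [hcoe x hv.1, hcoe y hy]
      exact_mod_cast this

theorem DPhi_eq_sumField {g : Euc d → EReal} (hg : ProperFn g) (x : Euc d) :
    DPhi N D g x = SumField D {x | g x ≠ ⊤} (fun x => (g x).toReal) x := by
  simp only [DPhi, SumField, Subdiff_eq_subdiffOn hg]

theorem ConvexFn.convexOn_toReal {g : Euc d → EReal} (hg : ConvexFn g) (hp : ProperFn g) :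
    ConvexOn ℝ {x | g x ≠ ⊤} fun x => (g x).toReal := by
  have hcoe : ∀ y, g y ≠ ⊤ → g y ≤ ((g y).toReal : EReal) := fun y hy =>
    (EReal.coe_toReal hy (hp.2 y)).ge
  have key : ∀ x, g x ≠ ⊤ → ∀ y, g y ≠ ⊤ → ∀ a b : ℝ, 0 ≤ a → 0 ≤ b → a + b = 1 →
      g (a • x + b • y) ≤ ((a * (g x).toReal + b * (g y).toReal : ℝ) : EReal) := by
    intro x hx y hy a b ha hb hab
    exact hg (x := (x, (g x).toReal)) (hcoe x hx) (y := (y, (g y).toReal)) (hcoe y hy) ha hb hab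
  refine ⟨fun x hx y hy a b ha hb hab => ?_, fun x hx y hy a b ha hb hab => ?_⟩
  · exact ((key x hx y hy a b ha hb hab).trans_lt (EReal.coe_lt_top _)).ne
  · have := EReal.toReal_le_toReal (key x hx y hy a b ha hb hab) (hp.2 _) (EReal.coe_ne_top _)
    rw [EReal.toReal_coe] at this
    simpa only [smul_eq_mul] using this

theorem StandingAssumptions.realAssumptions {g : Euc d → EReal}
    (h : StandingAssumptions N f D g) :
    ∃ c, RealAssumptions f D {x | g x ≠ ⊤} (fun x => (g x).toReal) c := by
  obtain ⟨hf, hD, hb, hne, hp, hconv, hcl, hlip, c, hc⟩ := h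
  refine ⟨c, hf, hD, hb, fun i x => (hne i x).1, fun i x => (hne i x).2, hcl,
    hconv.convexOn_toReal hp, fun x hx => ?_, fun x hx => ?_⟩
  · obtain ⟨ε, hε, K, hK⟩ := hlip x hx
    refine ⟨K.toNNReal, {y | g y ≠ ⊤} ∩ Metric.closedBall x ε, inter_mem self_mem_nhdsWithin
      (mem_nhdsWithin_of_mem_nhds (Metric.closedBall_mem_nhds x hε)),
      LipschitzOnWith.of_dist_le_mul fun y hy z hz => ?_⟩
    rw [Real.dist_eq, dist_eq_norm]
    exact (hK y hy.1 z hz.1 (mem_closedBall_iff_norm.1 hy.2) (mem_closedBall_iff_norm.1 hz.2)).trans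
      (mul_le_mul_of_nonneg_right (Real.le_coe_toNNReal K) (norm_nonneg _))
  · have := hc x
    rw [Phi, ← EReal.coe_toReal hx (hp.2 x)] at this
    exact_mod_cast this

theorem IsPRR.ne_top {g : Euc d → EReal} {α : ℕ → ℝ} {xs : ℕ → Euc d} (h : IsPRR N D g α xs)
    (hg : ProperFn g) (k : ℕ) : g (xs (k + 1)) ≠ ⊤ := by
  obtain ⟨⟨y₀, hy₀⟩, hbot⟩ := hg
  obtain ⟨σ, z, -, -, hmin⟩ := h k
  intro htop
  have := hmin y₀
  rw [htop, EReal.top_add_coe, top_le_iff] at this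
  rw [← EReal.coe_toReal hy₀ (hbot y₀)] at this
  exact EReal.coe_ne_top _ (by exact_mod_cast this)

theorem StandingAssumptions.exists_isApproxStep_of_isPRR {g : Euc d → EReal}
    (h : StandingAssumptions N f D g) (R : ℝ) :
    ∃ C ≥ (0 : ℝ), ∃ αbar > (0 : ℝ), ∀ (α : ℕ → ℝ) (xs : ℕ → Euc d), IsPRR N D g α xs →
      ∀ k, 0 < α k → α k ≤ αbar → g (xs k) ≠ ⊤ → ‖xs k‖ ≤ R →
      IsApproxStep D {x | g x ≠ ⊤} (fun x => (g x).toReal) C (α k) (xs k) (xs (k + 1)) := by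
  obtain ⟨c, hr⟩ := h.realAssumptions
  have hp : ProperFn g := h.2.2.2.2.1
  have hball := isCompact_closedBall (0 : Euc d) (R + 1)
  obtain ⟨L, hL0, hL⟩ := exists_norm_le_of_locBounded_family hr.locBounded hball
  obtain ⟨K, hK⟩ := (hr.lipschitzOn.mono inter_subset_left).exists_lipschitzOnWith_of_compact
    (hball.inter_left hr.isClosed)
  refine ⟨N * L + K, by positivity, 1 / (N * L + 1), by positivity,
    fun α xs hprr k hα hαbar hS hR => ?_⟩
  have hqS := hprr.ne_top hp k
  obtain ⟨σ, z, hz0, hz, hmin⟩ := hprr k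
  choose v hv hzv using hz
  have hNL : N * L * α k ≤ 1 := by
    rw [le_div_iff₀ (by positivity)] at hαbar
    linarith
  have hzbound : ∀ j : ℕ, j ≤ N → ‖z j - xs k‖ ≤ j * L * α k ∧
      ∀ i : Fin N, i.1 < j → ‖v i‖ ≤ L := by
    intro j hj
    induction j with
    | zero => simp [hz0]
    | succ j ih =>
      obtain ⟨h1, h2⟩ := ih (by omega)
      have hjN : (j : ℝ) * L * α k ≤ N * L * α k := by
        have : (j : ℝ) ≤ N := by exact_mod_cast (by omega : j ≤ N)
        gcongr
      have hvj : ‖v ⟨j, hj⟩‖ ≤ L := by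
        refine hL _ (z j) ?_ _ (hv ⟨j, hj⟩)
        rw [mem_closedBall_zero_iff]
        have := norm_le_norm_add_norm_sub' (z j) (xs k)
        linarith
      refine ⟨?_, fun i hi => ?_⟩
      · have hstep : z (j + 1) - xs k = (z j - xs k) - α k • v ⟨j, hj⟩ := by
          rw [hzv ⟨j, hj⟩]
          abel
        rw [hstep]
        refine (norm_sub_le _ _).trans ?_
        rw [norm_smul, Real.norm_of_nonneg hα.le]
        push_cast
        nlinarith
      · rcases Nat.lt_succ_iff_lt_or_eq.1 hi with hlt | heq
        · exact h2 i hlt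
        · obtain rfl : i = ⟨j, hj⟩ := Fin.ext heq
          exact hvj
  have hzN : z N = xs k - α k • ∑ i, v (σ.symm i) := by
    rw [Equiv.sum_comp σ.symm v]
    have hsum : ∑ i : Fin N, α k • v i = z 0 - z N := by
      rw [← Finset.sum_range_sub', ← Fin.sum_univ_eq_sum_range (fun j => z j - z (j + 1))]
      refine Finset.sum_congr rfl fun i _ => ?_
      rw [hzv i, sub_sub_cancel]
    rw [Finset.smul_sum, hsum, hz0, sub_sub_cancel]
  refine hr.convexOn.isApproxStep_of_isMin hα (by positivity) hS hqS
    (p := fun i => z (σ.symm i)) (v := fun i => v (σ.symm i)) (fun i => ?_) (fun i => ?_)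
    (fun i => (hzbound N le_rfl).2 _ (σ.symm i).2) ?_ fun w hw => ?_
  · refine ((hzbound _ (σ.symm i).2.le).1).trans ?_
    have : ((σ.symm i : ℕ) : ℝ) ≤ N := by exact_mod_cast (σ.symm i).2.le
    have hK0 : 0 ≤ K * α k := by positivity
    have : ((σ.symm i : ℕ) : ℝ) * L * α k ≤ N * L * α k := by gcongr
    linarith
  · simpa using hv (σ.symm i)
  · exact hr.convexOn.sub_le_of_lipschitzOnWith hK hS hR hqS
  · have := hmin w
    rw [hzN, ← EReal.coe_toReal hw (hp.2 w), ← EReal.coe_toReal hqS (hp.2 _)] at this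
    exact_mod_cast this

theorem IsDPhiTrajectory.continuousOn {g : Euc d → EReal} {x₀ : Euc d} {x u : ℝ → Euc d}
    (h : IsDPhiTrajectory N D g x₀ x u) : ContinuousOn x (Ici 0) := by
  have hcont : ∀ T : ℝ, 0 ≤ T → ContinuousOn x (Icc 0 T) := by
    intro T hT
    have := intervalIntegral.continuousOn_primitive_interval' (h.1 T hT) left_mem_uIcc
    rw [uIcc_of_le hT] at this
    exact (continuousOn_const.add this).congr fun t ht => h.2.2.1 t ht.1
  intro t ht
  refine (hcont (t + 1) (by linarith [mem_Ici.1 ht]) t ⟨ht, by linarith⟩).mono_of_mem_nhdsWithin ?_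
  rw [← Ici_inter_Iic]
  exact inter_mem self_mem_nhdsWithin
    (mem_nhdsWithin_of_mem_nhds (Iic_mem_nhds (lt_add_one t)))

end Reshuffling

/-- under the standing assumptions, if the `D_Φ`-trajectory from `x₀`
is unique and convergent, then proximal random reshuffling with small summable step
sizes adding up to a large enough `T` converges to an `(ε,0)`-near approximate
`D_Φ`-stationary point. -/
theorem stmt12 {d N : ℕ} (hN : 1 ≤ N) (f : Fin N → Euc d → ℝ)
    (D : Fin N → Euc d → Set (Euc d)) (g : Euc d → EReal)
    (hSA : StandingAssumptions N f D g)
    (ε : ℝ) (hε : 0 < ε) (x₀ : Euc d) (hx₀ : Phi N f g x₀ ≠ ⊤)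
    (xtraj utraj : ℝ → Euc d)
    (htraj : IsDPhiTrajectory N D g x₀ xtraj utraj)
    (huniq : ∀ x₂ u₂ : ℝ → Euc d, IsDPhiTrajectory N D g x₀ x₂ u₂ →
      ∀ t ≥ (0:ℝ), x₂ t = xtraj t)
    (hconv : ∃ xinf : Euc d, Filter.Tendsto xtraj Filter.atTop (nhds xinf)) :
    ∃ T₀ ≥ (0:ℝ), ∀ T ≥ T₀, ∃ αbar > (0:ℝ), ∀ (α : ℕ → ℝ) (xs : ℕ → Euc d),
      IsPRR N D g α xs → xs 0 = x₀ → (∀ k, 0 < α k ∧ α k ≤ αbar) →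
      HasSum α T →
      ∃ xstar : Euc d, Filter.Tendsto xs Filter.atTop (nhds xstar) ∧
        EMetric.infEdist (0 : Euc d)
          {v : Euc d | ∃ y : Euc d, ‖y - xstar‖ ≤ ε ∧ v ∈ DPhi N D g y} = 0 := by
  obtain ⟨c, hr⟩ := hSA.realAssumptions
  have hp : ProperFn g := hSA.2.2.2.2.1
  have hcont := htraj.continuousOn
  have hx₀S : g x₀ ≠ ⊤ := fun htop => hx₀ (by rw [Phi, htop, EReal.coe_add_top])
  have hagree : ∀ T > (0 : ℝ), ∀ y, IsLipschitzSolution D {x | g x ≠ ⊤} (fun x => (g x).toReal) T y →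
      y 0 = x₀ → ∀ t ∈ Icc 0 T, y t = xtraj t := by
    intro T hT y hy hy0 t ht
    obtain ⟨x, u, hu, hxu, hincl, hxy⟩ := hr.exists_extension hT hy
    rw [← hxy t ht]
    refine huniq x u ⟨hu, ?_, hxu, ?_⟩ t ht.1
    · rw [hxy 0 ⟨le_rfl, hT.le⟩, hy0]
    · simpa only [DPhi_eq_sumField hp] using hincl
  obtain ⟨xinf, hxinf⟩ := hconv
  obtain ⟨T₁, hT₁⟩ := Metric.tendsto_atTop.1 hxinf (ε / 4) (by positivity)
  refine ⟨max T₁ 0, le_max_right _ _, fun T hT => ?_⟩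
  have hT0 : 0 ≤ T := (le_max_right _ _).trans hT
  obtain ⟨M, hM⟩ := (isCompact_Icc.image_of_continuousOn
    (hcont.mono (Icc_subset_Ici_self : Icc 0 T ⊆ Ici 0))).isBounded.exists_norm_le
  have hδ : 0 < min 1 (ε / 2) := by positivity
  obtain ⟨C, hC, a₁, ha₁, hstep⟩ := hSA.exists_isApproxStep_of_isPRR (M + 1)
  obtain ⟨a₂, ha₂, htrack⟩ := hr.exists_step_bound hcont (x₀ := x₀) (fun τ hτ y hy hy0 => by
    rcases hτ.eq_or_lt with rfl | hτ
    · rw [hy0, htraj.2.1]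
    · exact hagree τ hτ y hy hy0 τ ⟨hτ.le, le_rfl⟩) hC T hδ
  refine ⟨min a₁ a₂, lt_min ha₁ ha₂, fun α xs hprr hxs0 hα hsum => ?_⟩
  have hS : ∀ k, g (xs k) ≠ ⊤ := by
    rintro (_ | k)
    · rwa [hxs0]
    · exact hprr.ne_top hp k
  have hpart : ∀ k, ∑ j ∈ Finset.range k, α j ∈ Icc 0 T := fun k =>
    ⟨Finset.sum_nonneg fun j _ => (hα j).1.le,
      sum_le_hasSum _ (fun j _ => (hα j).1.le) hsum⟩
  have htrackAll : ∀ k, (∀ j < k, ‖xs j‖ ≤ M + 1) →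
      ‖xs k - xtraj (∑ j ∈ Finset.range k, α j)‖ ≤ min 1 (ε / 2) := fun k hk =>
    htrack α xs k hxs0 (fun j _ => ⟨(hα j).1, (hα j).2.trans (min_le_right _ _)⟩)
      (fun j _ => hS j)
      (fun j hj => hstep α xs hprr j (hα j).1 ((hα j).2.trans (min_le_left _ _)) (hS j) (hk j hj))
      (hpart k).2
  have hbound : ∀ k, ‖xs k‖ ≤ M + 1 := by
    intro k
    induction k using Nat.strong_induction_on with
    | _ k ih =>
      have h1 := (htrackAll k ih).trans (min_le_left _ _)
      have h2 := hM _ (mem_image_of_mem xtraj (hpart k))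
      have h3 := norm_le_norm_add_norm_sub' (xs k) (xtraj (∑ j ∈ Finset.range k, α j))
      linarith
  have hcauchy : CauchySeq xs := by
    refine cauchySeq_of_dist_le_of_summable (fun k => C * α k) (fun k => ?_)
      (hsum.summable.mul_left C)
    rw [dist_comm, dist_eq_norm]
    exact (hstep α xs hprr k (hα k).1 ((hα k).2.trans (min_le_left _ _)) (hS k)
      (hbound k)).norm_sub_le (hα k).1.le
  obtain ⟨xstar, hxstar⟩ := cauchySeq_tendsto_of_complete hcauchy
  refine ⟨xstar, hxstar, ?_⟩
  have hdist : ‖xstar - xtraj T‖ ≤ ε / 2 := by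
    have hxt : Tendsto (fun k => xtraj (∑ j ∈ Finset.range k, α j)) atTop (𝓝 (xtraj T)) :=
      (hcont T hT0).tendsto.comp (tendsto_nhdsWithin_iff.2
        ⟨hsum.tendsto_sum_nat, Eventually.of_forall fun k => (hpart k).1⟩)
    exact le_of_tendsto (hxstar.sub hxt).norm (Eventually.of_forall fun k =>
      (htrackAll k fun j _ => hbound j).trans (min_le_right _ _))
  refine le_antisymm (ENNReal.le_of_forall_pos_le_add fun δ hδ0 _ => ?_) zero_le
  have hδ0 : (0 : ℝ) < δ := hδ0
  obtain ⟨B, hB⟩ := exists_gt (max ((∑ i, f i x₀ + (g x₀).toReal - c) / (δ : ℝ) ^ 2) 0)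
  have hB0 : 0 < B := (le_max_right _ _).trans_lt hB
  obtain ⟨y, hy, hy0⟩ := hr.exists_solution hx₀S (T := T + B) (by positivity)
  obtain ⟨t, ht, hnorm, hmem⟩ := hr.exists_norm_deriv_lt hT0 hB0 hδ0 hy (by
    rw [hy0, ← div_lt_iff₀ (by positivity)]
    exact (le_max_left _ _).trans_lt hB)
  rw [hagree _ (by positivity) y hy hy0 t ⟨hT0.trans ht.1.le, ht.2.le⟩, ← DPhi_eq_sumField hp]
    at hmem
  have hT₁T : T₁ ≤ T := (le_max_left _ _).trans hT
  have hnear : ‖xtraj t - xstar‖ ≤ ε := by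
    have h1 := hT₁ t (hT₁T.trans ht.1.le)
    have h2 := hT₁ T hT₁T
    rw [← dist_eq_norm] at hdist ⊢
    have h3 := dist_triangle4 (xtraj t) xinf (xtraj T) xstar
    rw [dist_comm xinf, dist_comm (xtraj T) xstar] at h3
    linarith
  have hmem' : -deriv y t ∈ {v : Euc d | ∃ y : Euc d, ‖y - xstar‖ ≤ ε ∧ v ∈ DPhi N D g y} :=
    ⟨xtraj t, hnear, hmem⟩
  refine (Metric.infEDist_le_edist_of_mem hmem').trans ?_
  rw [zero_add, edist_zero_left]
  refine ENNReal.coe_le_coe.2 ?_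
  rw [nnnorm_neg]
  exact_mod_cast hnorm.le
end
end

section
/- (Approximate descent) Let f₁,…,f_N : ℝ^d → ℝ be differentiable with locally Lipschitz gradients, let g : ℝ^d → ℝ ∪ {+∞} be proper and convex with closed domain and locally Lipschitz on its domain, set f := f₁ + ⋯ + f_N and Φ := f + g, and let X ⊂ ℝ^d be a bounded set. Let L ≥ 1 be a common Lipschitz constant of f₁,…,f_N on B(X,2) and M ≥ 1 a common Lipschitz constant of ∇f₁,…,∇f_N on the convex hull of B(X,1). Then there exists ᾱ > 0 such that: whenever K ∈ ℕ, x₀,…,x_K ∈ X, x_{K+1} ∈ ℝ^d, α₀,…,α_K ∈ (0, ᾱ], and for each k ∈ {0,…,K} there are a permutation σ^k of {1,…,N} and inner iterates x_{k,0} = x_k, x_{k,i} = x_{k,i−1} − α_k ∇f_{σ^k(i)}(x_{k,i−1}) for i = 1,…,N, and x_{k+1} = prox_{α_k g}(x_{k,N}), one has for all k ∈ {0,…,K}: Φ(x_{k+1}) ≤ Φ(x_k) − (α_k/4)·(inf{‖∇f(x_{k+1}) + w‖ : w ∈ ∂g(x_{k+1})})² − (1/(8α_k))·‖x_{k+1}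 − x_k‖² + (1/12)(N−1)²N(2N−1)L²M²α_k³. -/
open scoped RealInnerProductSpace
open MeasureTheory

noncomputable section

/-- `B(X,r) = {y : ∃ s ∈ X, ‖y − s‖ ≤ r}`. -/
def BallSet {d : ℕ} (X : Set (Euc d)) (r : ℝ) : Set (Euc d) :=
  {y : Euc d | ∃ s ∈ X, ‖y - s‖ ≤ r}

section Auxiliary

variable {d : ℕ}

lemma coe_toReal_of_proper {g : Euc d → EReal} (hgp : ProperFn g) {x : Euc d} (hx : g x ≠ ⊤) :
    (((g x).toReal : ℝ) : EReal) = g x :=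
  EReal.coe_toReal hx (hgp.2 x)

lemma ConvexFn.segment_le {g : Euc d → EReal} (hgc : ConvexFn g) (hgp : ProperFn g)
    {a b : Euc d} (ha : g a ≠ ⊤) (hb : g b ≠ ⊤) {t : ℝ} (ht0 : 0 ≤ t) (ht1 : t ≤ 1) :
    g (a + t • (b - a)) ≤ (((1 - t) * (g a).toReal + t * (g b).toReal : ℝ) : EReal) := by
  have h1 : (a, (g a).toReal) ∈ {p : Euc d × ℝ | g p.1 ≤ (p.2 : EReal)} :=
    (coe_toReal_of_proper hgp ha).ge
  have h2 : (b, (g b).toReal) ∈ {p : Euc d × ℝ | g p.1 ≤ (p.2 : EReal)} :=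
    (coe_toReal_of_proper hgp hb).ge
  have h := hgc h1 h2 (sub_nonneg.2 ht1) ht0 (sub_add_cancel 1 t)
  have e : (1 - t) • a + t • b = a + t • (b - a) := by module
  simpa [e] using h

lemma ConvexFn.segment_ne_top {g : Euc d → EReal} (hgc : ConvexFn g) (hgp : ProperFn g)
    {a b : Euc d} (ha : g a ≠ ⊤) (hb : g b ≠ ⊤) {t : ℝ} (ht0 : 0 ≤ t) (ht1 : t ≤ 1) :
    g (a + t • (b - a)) ≠ ⊤ :=
  ((hgc.segment_le hgp ha hb ht0 ht1).trans_lt (EReal.coe_lt_top _)).ne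

lemma ConvexFn.segment_toReal_le {g : Euc d → EReal} (hgc : ConvexFn g) (hgp : ProperFn g)
    {a b : Euc d} (ha : g a ≠ ⊤) (hb : g b ≠ ⊤) {t : ℝ} (ht0 : 0 ≤ t) (ht1 : t ≤ 1) :
    (g (a + t • (b - a))).toReal ≤ (1 - t) * (g a).toReal + t * (g b).toReal := by
  have h := hgc.segment_le hgp ha hb ht0 ht1
  rw [← coe_toReal_of_proper hgp (hgc.segment_ne_top hgp ha hb ht0 ht1)] at h
  exact_mod_cast h

/-- A convex function decreases at most linearly away from `x` when it is Lipschitz near `x`. -/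
lemma ConvexFn.sub_le_of_local {g : Euc d → EReal} (hgc : ConvexFn g) (hgp : ProperFn g)
    {x : Euc d} (hx : g x ≠ ⊤) {δ C : ℝ} (hδ : 0 < δ)
    (hloc : ∀ y, g y ≠ ⊤ → ‖y - x‖ ≤ δ → (g x).toReal - (g y).toReal ≤ C * ‖y - x‖)
    {w : Euc d} (hw : g w ≠ ⊤) :
    (g x).toReal - (g w).toReal ≤ C * ‖w - x‖ := by
  have hn : 0 ≤ ‖w - x‖ := norm_nonneg _
  set t : ℝ := min 1 (δ / (‖w - x‖ + 1)) with ht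
  have ht0 : 0 < t := lt_min one_pos (by positivity)
  have ht1 : t ≤ 1 := min_le_left _ _
  have hnorm : ‖x + t • (w - x) - x‖ = t * ‖w - x‖ := by
    rw [add_sub_cancel_left, norm_smul, Real.norm_of_nonneg ht0.le]
  have htδ : t * ‖w - x‖ ≤ δ := by
    have h1 : t * (‖w - x‖ + 1) ≤ δ := by
      rw [← le_div_iff₀ (by positivity)]
      exact min_le_right _ _
    nlinarith
  have h1 := hloc _ (hgc.segment_ne_top hgp hx hw ht0.le ht1) (hnorm.trans_le htδ)
  have h2 := hgc.segment_toReal_le hgp hx hw ht0.le ht1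
  rw [hnorm] at h1
  have h3 : t * ((g x).toReal - (g w).toReal) ≤ t * (C * ‖w - x‖) := by linarith
  exact le_of_mul_le_mul_left h3 ht0

lemma exists_uniform_linear_decrease {g : Euc d → EReal} (hgc : ConvexFn g) (hgp : ProperFn g)
    (hgdom : IsClosed {x : Euc d | g x ≠ ⊤}) (hglip : LocLipOnDom g)
    {X : Set (Euc d)} (hX : Bornology.IsBounded X) :
    ∃ C : ℝ, 0 ≤ C ∧ ∀ x ∈ X, g x ≠ ⊤ → ∀ w, g w ≠ ⊤ →
      (g x).toReal - (g w).toReal ≤ C * ‖w - x‖ := by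
  have hcomp : IsCompact (closure X ∩ {x : Euc d | g x ≠ ⊤}) :=
    hX.isCompact_closure.inter_right hgdom
  obtain ⟨C, hC0, hC⟩ : ∃ C : ℝ, 0 ≤ C ∧ ∀ x ∈ closure X ∩ {x : Euc d | g x ≠ ⊤}, g x ≠ ⊤ →
      ∀ w, g w ≠ ⊤ → (g x).toReal - (g w).toReal ≤ C * ‖w - x‖ := by
    refine hcomp.induction_on (p := fun S => ∃ C : ℝ, 0 ≤ C ∧ ∀ x ∈ S, g x ≠ ⊤ →
      ∀ w, g w ≠ ⊤ → (g x).toReal - (g w).toReal ≤ C * ‖w - x‖) ?_ ?_ ?_ ?_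
    · exact ⟨0, le_rfl, by simp⟩
    · rintro S T hST ⟨C, h0, h⟩
      exact ⟨C, h0, fun x hx => h x (hST hx)⟩
    · rintro S T ⟨C, h0, h⟩ ⟨C', h0', h'⟩
      refine ⟨max C C', h0.trans (le_max_left _ _), ?_⟩
      rintro x (hx | hx) hx' w hw
      · exact (h x hx hx' w hw).trans
          (mul_le_mul_of_nonneg_right (le_max_left _ _) (norm_nonneg _))
      · exact (h' x hx hx' w hw).trans
          (mul_le_mul_of_nonneg_right (le_max_right _ _) (norm_nonneg _))
    · rintro x₀ ⟨-, hx₀⟩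
      obtain ⟨ε, hε, C, hC⟩ := hglip x₀ hx₀
      refine ⟨Metric.ball x₀ (ε / 2), mem_nhdsWithin_of_mem_nhds
        (Metric.ball_mem_nhds _ (half_pos hε)), max C 0, le_max_right _ _, ?_⟩
      intro x hx hx' w hw
      rw [mem_ball_iff_norm] at hx
      refine hgc.sub_le_of_local hgp hx' (half_pos hε) ?_ hw
      intro y hy hyx
      have hy₀ : ‖y - x₀‖ ≤ ε := by
        have := norm_sub_le_norm_sub_add_norm_sub y x x₀
        linarith
      have h := (le_abs_self _).trans (hC x hx' y hy (by linarith) hy₀)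
      rw [norm_sub_rev] at h
      exact h.trans (mul_le_mul_of_nonneg_right (le_max_left _ _) (norm_nonneg _))
  exact ⟨C, hC0, fun x hx hx' => hC x ⟨subset_closure hx, hx'⟩ hx'⟩

section Prox

variable {g : Euc d → EReal} {a : ℝ} {y z : Euc d}

lemma prox_ne_top (hgp : ProperFn g)
    (hprox : ∀ w, g y + ((‖y - z‖ ^ 2 / (2 * a) : ℝ) : EReal) ≤
      g w + ((‖w - z‖ ^ 2 / (2 * a) : ℝ) : EReal)) : g y ≠ ⊤ := by
  intro hy
  obtain ⟨w, hw⟩ := hgp.1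
  have h := hprox w
  rw [hy, EReal.top_add_coe, ← coe_toReal_of_proper hgp hw, ← EReal.coe_add] at h
  exact absurd h (EReal.coe_lt_top _).not_ge

lemma prox_toReal_le (hgp : ProperFn g)
    (hprox : ∀ w, g y + ((‖y - z‖ ^ 2 / (2 * a) : ℝ) : EReal) ≤
      g w + ((‖w - z‖ ^ 2 / (2 * a) : ℝ) : EReal)) {w : Euc d} (hw : g w ≠ ⊤) :
    (g y).toReal + ‖y - z‖ ^ 2 / (2 * a) ≤ (g w).toReal + ‖w - z‖ ^ 2 / (2 * a) := by
  have h := hprox w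
  rw [← coe_toReal_of_proper hgp hw, ← coe_toReal_of_proper hgp (prox_ne_top hgp hprox)] at h
  exact_mod_cast h

lemma prox_subgradient_toReal (hgc : ConvexFn g) (hgp : ProperFn g) (ha : 0 < a)
    (hprox : ∀ w, g y + ((‖y - z‖ ^ 2 / (2 * a) : ℝ) : EReal) ≤
      g w + ((‖w - z‖ ^ 2 / (2 * a) : ℝ) : EReal)) {w : Euc d} (hw : g w ≠ ⊤) :
    (g y).toReal + ⟪a⁻¹ • (z - y), w - y⟫ ≤ (g w).toReal := by
  have hy := prox_ne_top hgp hprox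
  have key : ∀ t : ℝ, 0 < t → t ≤ 1 →
      (g y).toReal + ⟪a⁻¹ • (z - y), w - y⟫ ≤ (g w).toReal + t * (‖w - y‖ ^ 2 / (2 * a)) := by
    intro t ht0 ht1
    have h1 := prox_toReal_le hgp hprox (hgc.segment_ne_top hgp hy hw ht0.le ht1)
    have h2 := hgc.segment_toReal_le hgp hy hw ht0.le ht1
    have h3 : ‖y + t • (w - y) - z‖ ^ 2 =
        ‖y - z‖ ^ 2 - 2 * t * ⟪z - y, w - y⟫ + t ^ 2 * ‖w - y‖ ^ 2 := by
      have e : y + t • (w - y) - z = t • (w - y) - (z - y) := by abel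
      rw [e, norm_sub_sq_real, norm_smul, real_inner_smul_left, mul_pow, Real.norm_eq_abs, sq_abs,
        real_inner_comm, norm_sub_rev z y]
      ring
    rw [h3] at h1
    rw [real_inner_smul_left]
    have h4 : (‖y - z‖ ^ 2 - 2 * t * ⟪z - y, w - y⟫ + t ^ 2 * ‖w - y‖ ^ 2) / (2 * a) =
        ‖y - z‖ ^ 2 / (2 * a) - t * (a⁻¹ * ⟪z - y, w - y⟫) + t * (t * (‖w - y‖ ^ 2 / (2 * a))) := by
      field_simp
    rw [h4] at h1
    refine le_of_mul_le_mul_left ?_ ht0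
    linarith
  set c := ‖w - y‖ ^ 2 / (2 * a) with hc
  have hc0 : 0 ≤ c := by positivity
  refine le_of_forall_pos_le_add fun ε hε => ?_
  have ht0 : 0 < min 1 (ε / (c + 1)) := lt_min one_pos (by positivity)
  refine (key _ ht0 (min_le_left _ _)).trans ?_
  have h1 : min 1 (ε / (c + 1)) * (c + 1) ≤ ε := by
    rw [← le_div_iff₀ (by positivity)]
    exact min_le_right _ _
  nlinarith

lemma prox_mem_subdiff (hgc : ConvexFn g) (hgp : ProperFn g) (ha : 0 < a)
    (hprox : ∀ w, g y + ((‖y - z‖ ^ 2 / (2 * a) : ℝ) : EReal) ≤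
      g w + ((‖w - z‖ ^ 2 / (2 * a) : ℝ) : EReal)) : a⁻¹ • (z - y) ∈ Subdiff g y := by
  intro w
  by_cases hw : g w = ⊤
  · rw [hw]; exact le_top
  · have h := prox_subgradient_toReal hgc hgp ha hprox hw
    rw [← coe_toReal_of_proper hgp hw, ← coe_toReal_of_proper hgp (prox_ne_top hgp hprox)]
    exact_mod_cast h

lemma prox_displacement_le (hgp : ProperFn g) (ha : 0 < a)
    (hprox : ∀ w, g y + ((‖y - z‖ ^ 2 / (2 * a) : ℝ) : EReal) ≤
      g w + ((‖w - z‖ ^ 2 / (2 * a) : ℝ) : EReal)) {x : Euc d} (hx : g x ≠ ⊤) {C : ℝ}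
    (hC : 0 ≤ C) (hdec : ∀ w, g w ≠ ⊤ → (g x).toReal - (g w).toReal ≤ C * ‖w - x‖) :
    ‖y - x‖ ≤ 2 * ‖z - x‖ + 2 * a * C := by
  have h1 := prox_toReal_le hgp hprox hx
  have h2 := hdec y (prox_ne_top hgp hprox)
  have h3 : ‖y - z‖ ^ 2 / (2 * a) ≤ C * ‖y - x‖ + ‖x - z‖ ^ 2 / (2 * a) := by linarith
  have h4 : ‖y - z‖ ^ 2 ≤ 2 * a * (C * ‖y - x‖) + ‖x - z‖ ^ 2 := by
    rw [div_le_iff₀ (by positivity)] at h3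
    have e : ‖x - z‖ ^ 2 / (2 * a) * (2 * a) = ‖x - z‖ ^ 2 := by field_simp
    linarith [e, add_mul (C * ‖y - x‖) (‖x - z‖ ^ 2 / (2 * a)) (2 * a)]
  have h5 : ‖y - z‖ ^ 2 = ‖y - x‖ ^ 2 - 2 * ⟪y - x, z - x⟫ + ‖z - x‖ ^ 2 := by
    rw [← norm_sub_sq_real, sub_sub_sub_cancel_right]
  have h6 := real_inner_le_norm (y - x) (z - x)
  rw [norm_sub_rev x z] at h4
  rcases (norm_nonneg (y - x)).eq_or_lt with h0 | h0
  · rw [← h0]; positivity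
  · refine le_of_mul_le_mul_left ?_ h0
    nlinarith

end Prox

lemma norm_gradient_le_of_lipschitz_near {h : Euc d → ℝ} {X : Set (Euc d)} {L : ℝ} (hL : 0 ≤ L)
    (hLf : ∀ y ∈ BallSet X 2, ∀ z ∈ BallSet X 2, |h y - h z| ≤ L * ‖y - z‖)
    {y : Euc d} (hy : y ∈ BallSet X 1) : ‖gradient h y‖ ≤ L := by
  obtain ⟨s, hs, hys⟩ := hy
  rw [gradient, LinearIsometryEquiv.norm_map]
  refine norm_fderiv_le_of_lip' ℝ hL ?_
  filter_upwards [Metric.ball_mem_nhds y one_pos] with w hw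
  rw [mem_ball_iff_norm] at hw
  refine hLf w ⟨s, hs, ?_⟩ y ⟨s, hs, by linarith⟩
  have := norm_sub_le_norm_sub_add_norm_sub w y s
  linarith

lemma le_add_inner_gradient {h : Euc d → ℝ} (hd : Differentiable ℝ h) {s : Set (Euc d)}
    (hs : Convex ℝ s) {M : ℝ} (hM : 0 ≤ M)
    (hMf : ∀ y ∈ s, ∀ z ∈ s, ‖gradient h y - gradient h z‖ ≤ M * ‖y - z‖)
    {x y : Euc d} (hx : x ∈ s) (hy : y ∈ s) :
    h y ≤ h x + ⟪gradient h x, y - x⟫ + M * ‖y - x‖ ^ 2 := by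
  have hseg : segment ℝ x y ⊆ s := hs.segment_subset hx hy
  have key := (convex_segment x y).norm_image_sub_le_of_norm_hasFDerivWithin_le'
    (f := h) (f' := fderiv ℝ h) (φ := fderiv ℝ h x) (C := M * ‖y - x‖)
    (fun w _ => (hd w).hasFDerivAt.hasFDerivWithinAt) (fun w hw => ?_)
    (left_mem_segment ℝ x y) (right_mem_segment ℝ x y)
  · have e : fderiv ℝ h x (y - x) = ⟪gradient h x, y - x⟫ := by
      rw [gradient, InnerProductSpace.toDual_symm_apply]
    rw [e] at key
    have := (le_abs_self _).trans key
    nlinarith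
  · have e : ‖fderiv ℝ h w - fderiv ℝ h x‖ = ‖gradient h w - gradient h x‖ := by
      rw [gradient, gradient, ← map_sub, LinearIsometryEquiv.norm_map]
    rw [e]
    refine (hMf w (hseg hw) x hx).trans (mul_le_mul_of_nonneg_left ?_ hM)
    obtain ⟨t, ⟨ht0, ht1⟩, rfl⟩ := (segment_eq_image' ℝ x y ▸ hw :
      w ∈ (fun θ : ℝ => x + θ • (y - x)) '' Set.Icc 0 1)
    simp only [add_sub_cancel_left, norm_smul, Real.norm_of_nonneg ht0]
    exact mul_le_of_le_one_left (norm_nonneg _) ht1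

lemma gradient_fun_sum {N : ℕ} {f : Fin N → Euc d → ℝ} (hd : ∀ i, Differentiable ℝ (f i))
    (x : Euc d) : gradient (fun y => ∑ i, f i y) x = ∑ i, gradient (f i) x := by
  simp only [gradient]
  rw [fderiv_fun_sum fun i _ => hd i x, map_sum]

/-- The quadratic estimate behind the descent inequality: `u` is the step, `E` the gradient error
of the inner loop and `D` the change of the gradient along the step. -/
lemma quadratic_descent_bound {a δ : ℝ} (ha : 0 < a) (hδ : a * δ ≤ 1 / 8) {u E D : Euc d}
    (hD : ‖D‖ ≤ δ * ‖u‖) :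
    a / 4 * ‖-(a⁻¹ • u) + E + D‖ ^ 2 + ‖u‖ ^ 2 / (8 * a) + ⟪E, u⟫ - ‖u‖ ^ 2 / a + δ * ‖u‖ ^ 2 ≤
      a / 2 * ‖E‖ ^ 2 := by
  obtain ⟨v, rfl⟩ : ∃ v, u = a • v := ⟨a⁻¹ • u, by rw [smul_inv_smul₀ ha.ne']⟩
  rw [inv_smul_smul₀ ha.ne', norm_smul, Real.norm_of_nonneg ha.le, real_inner_smul_right]
  rw [norm_smul, Real.norm_of_nonneg ha.le] at hD
  have hv := norm_nonneg v
  have hE := norm_nonneg E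
  have hDn := norm_nonneg D
  have hD' : ‖D‖ ≤ 1 / 8 * ‖v‖ := hD.trans (by nlinarith)
  have e : ‖-v + E + D‖ ^ 2 = ‖v‖ ^ 2 + ‖E‖ ^ 2 + ‖D‖ ^ 2 - 2 * ⟪E, v⟫ - 2 * ⟪v, D⟫ + 2 * ⟪E, D⟫ := by
    rw [norm_add_sq_real, norm_add_sq_real, norm_neg, inner_add_left, inner_neg_left,
      inner_neg_left, real_inner_comm v E]
    ring
  have h1 := real_inner_le_norm E v
  have h2 := real_inner_le_norm E D
  have h3 := (neg_le_abs _).trans (abs_real_inner_le_norm v D)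
  have h4 : ‖E‖ * ‖D‖ ≤ 1 / 8 * (‖E‖ * ‖v‖) := by nlinarith
  have h5 : ‖v‖ * ‖D‖ ≤ 1 / 8 * ‖v‖ ^ 2 := by nlinarith
  have h6 : ‖D‖ ^ 2 ≤ 1 / 64 * ‖v‖ ^ 2 := by nlinarith
  have h7 : a * δ * ‖v‖ ^ 2 ≤ 1 / 8 * ‖v‖ ^ 2 := by gcongr
  have e1 : (a * ‖v‖) ^ 2 / (8 * a) = a * (‖v‖ ^ 2 / 8) := by field_simp
  have e2 : (a * ‖v‖) ^ 2 / a = a * ‖v‖ ^ 2 := by field_simp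
  rw [e, e1, e2]
  have main : 1 / 4 * (‖v‖ ^ 2 + ‖E‖ ^ 2 + ‖D‖ ^ 2 - 2 * ⟪E, v⟫ - 2 * ⟪v, D⟫ + 2 * ⟪E, D⟫) +
      ‖v‖ ^ 2 / 8 + ⟪E, v⟫ - ‖v‖ ^ 2 + a * δ * ‖v‖ ^ 2 ≤ 1 / 2 * ‖E‖ ^ 2 := by
    nlinarith [sq_nonneg (‖E‖ - 9 / 8 * ‖v‖)]
  have := mul_le_mul_of_nonneg_left main ha.le
  nlinarith

lemma sum_range_cast_real (n : ℕ) : ∑ i ∈ Finset.range n, (i : ℝ) = n * (n - 1) / 2 := by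
  induction n with
  | zero => simp
  | succ n ih => rw [Finset.sum_range_succ, ih]; push_cast; ring

section InnerLoop

variable {N : ℕ} {F : Fin N → Euc d → Euc d} {a L : ℝ} {z : ℕ → Euc d} {X : Set (Euc d)}

lemma inner_iterate_dist_le (ha : 0 ≤ a) (hL : 0 ≤ L) (haL : a * (N * L) ≤ 1)
    (hz0 : z 0 ∈ X) (hF : ∀ i, ∀ y ∈ BallSet X 1, ‖F i y‖ ≤ L)
    (hz : ∀ i : Fin N, z (i.1 + 1) = z i.1 - a • F i (z i.1)) {n : ℕ} (hn : n ≤ N) :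
    ‖z n - z 0‖ ≤ a * (n * L) := by
  induction n with
  | zero => simp
  | succ n ih =>
    have ih := ih (by omega)
    have hnN : (n : ℝ) ≤ N := by exact_mod_cast (by omega : n ≤ N)
    have hmem : z n ∈ BallSet X 1 :=
      ⟨z 0, hz0, ih.trans (le_trans (by gcongr) haL)⟩
    have hs := hz ⟨n, hn⟩
    simp only at hs
    have hb : ‖a • F ⟨n, hn⟩ (z n)‖ ≤ a * L := by
      rw [norm_smul, Real.norm_of_nonneg ha]
      exact mul_le_mul_of_nonneg_left (hF _ _ hmem) ha
    rw [hs, sub_right_comm]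
    refine (norm_sub_le _ _).trans ?_
    push_cast
    linarith

lemma inner_loop_eq (hz : ∀ i : Fin N, z (i.1 + 1) = z i.1 - a • F i (z i.1)) :
    z N - z 0 = -(a • ∑ i, F i (z i.1)) := by
  rw [← Finset.sum_range_sub, ← Fin.sum_univ_eq_sum_range (fun i => z (i + 1) - z i),
    Finset.smul_sum, ← Finset.sum_neg_distrib]
  exact Finset.sum_congr rfl fun i _ => by rw [hz i]; abel

lemma inner_loop_error_le {M : ℝ} (ha : 0 ≤ a) (hL : 0 ≤ L) (hM : 0 ≤ M) (haL : a * (N * L) ≤ 1)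
    (hz0 : z 0 ∈ X) (hF : ∀ i, ∀ y ∈ BallSet X 1, ‖F i y‖ ≤ L)
    (hFM : ∀ i, ∀ y ∈ BallSet X 1, ∀ w ∈ BallSet X 1, ‖F i y - F i w‖ ≤ M * ‖y - w‖)
    (hz : ∀ i : Fin N, z (i.1 + 1) = z i.1 - a • F i (z i.1)) :
    ‖∑ i, F i (z 0) - ∑ i, F i (z i.1)‖ ≤ M * a * L * (N * (N - 1) / 2) := by
  have hterm : ∀ i : Fin N, ‖F i (z 0) - F i (z i.1)‖ ≤ M * a * L * (i.1 : ℝ) := by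
    intro i
    have hd := inner_iterate_dist_le ha hL haL hz0 hF hz i.2.le
    have hiN : (i.1 : ℝ) ≤ N := by exact_mod_cast i.2.le
    have hmem : z i.1 ∈ BallSet X 1 := ⟨z 0, hz0, hd.trans (le_trans (by gcongr) haL)⟩
    rw [norm_sub_rev]
    refine (hFM i _ hmem _ ⟨z 0, hz0, by simp⟩).trans ?_
    nlinarith [mul_le_mul_of_nonneg_left hd hM]
  rw [← Finset.sum_sub_distrib]
  refine (norm_sum_le_of_le _ fun i _ => hterm i).trans_eq ?_
  rw [← Finset.mul_sum, Fin.sum_univ_eq_sum_range (fun i => (i : ℝ))]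
  rw [sum_range_cast_real]

end InnerLoop

lemma half_sq_error_le {N : ℕ} (hN : 1 ≤ N) {a L M e : ℝ} (ha : 0 ≤ a) (he0 : 0 ≤ e)
    (he : e ≤ M * a * L * (N * (N - 1) / 2)) :
    a / 2 * e ^ 2 ≤ (1/12) * ((N:ℝ) - 1) ^ 2 * N * (2 * N - 1) * L ^ 2 * M ^ 2 * a ^ 3 := by
  have h1 : e ^ 2 ≤ (M * a * L * (N * (N - 1) / 2)) ^ 2 := pow_le_pow_left₀ he0 he 2
  have h2 : ((N:ℝ) - 1) ^ 2 * N * (3 * N) ≤ ((N:ℝ) - 1) ^ 2 * N * (2 * (2 * N - 1)) := by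
    rcases hN.eq_or_lt with rfl | h
    · simp
    · have : (2:ℝ) ≤ N := by exact_mod_cast h
      exact mul_le_mul_of_nonneg_left (by linarith) (by positivity)
  calc a / 2 * e ^ 2 ≤ a / 2 * (M * a * L * (N * (N - 1) / 2)) ^ 2 := by gcongr
    _ = (L ^ 2 * M ^ 2 * a ^ 3 / 24) * (((N:ℝ) - 1) ^ 2 * N * (3 * N)) := by ring
    _ ≤ (L ^ 2 * M ^ 2 * a ^ 3 / 24) * (((N:ℝ) - 1) ^ 2 * N * (2 * (2 * N - 1))) := by gcongr
    _ = _ := by ring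

end Auxiliary

/-- approximate descent: proximal random reshuffling with smooth
`f_i`'s satisfies, for small enough step sizes,
`Φ(x_{k+1}) ≤ Φ(x_k) − (α_k/4)·d(0, ∇f(x_{k+1}) + ∂g(x_{k+1}))²
  − ‖x_{k+1} − x_k‖²/(8α_k) + (1/12)(N−1)²N(2N−1)L²M²α_k³`. -/
theorem stmt14 {d N : ℕ} (hN : 1 ≤ N) (f : Fin N → Euc d → ℝ)
    (hdiff : ∀ i, Differentiable ℝ (f i))
    (hgradlip : ∀ i, LocallyLipschitz (gradient (f i)))
    (g : Euc d → EReal) (hgp : ProperFn g) (hgc : ConvexFn g)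
    (hgdom : IsClosed {x : Euc d | g x ≠ ⊤}) (hglip : LocLipOnDom g)
    (X : Set (Euc d)) (hX : Bornology.IsBounded X)
    (L : ℝ) (hL : 1 ≤ L)
    (hLf : ∀ i, ∀ y ∈ BallSet X 2, ∀ z ∈ BallSet X 2, |f i y - f i z| ≤ L * ‖y - z‖)
    (M : ℝ) (hM : 1 ≤ M)
    (hMf : ∀ i, ∀ y ∈ convexHull ℝ (BallSet X 1), ∀ z ∈ convexHull ℝ (BallSet X 1),
      ‖gradient (f i) y - gradient (f i) z‖ ≤ M * ‖y - z‖) :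
    ∃ αbar > (0:ℝ), ∀ (K : ℕ) (x : ℕ → Euc d) (α : ℕ → ℝ)
      (σ : ℕ → Equiv.Perm (Fin N)) (z : ℕ → ℕ → Euc d),
      (∀ k ≤ K, x k ∈ X) →
      (∀ k ≤ K, 0 < α k ∧ α k ≤ αbar) →
      (∀ k ≤ K, z k 0 = x k) →
      (∀ k ≤ K, ∀ i : Fin N,
        z k (i.1 + 1) = z k i.1 - α k • gradient (f (σ k i)) (z k i.1)) →
      (∀ k ≤ K, ∀ w : Euc d,
        g (x (k+1)) + ((‖x (k+1) - z k N‖ ^ 2 / (2 * α k) : ℝ) : EReal) ≤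
          g w + ((‖w - z k N‖ ^ 2 / (2 * α k) : ℝ) : EReal)) →
      ∀ k ≤ K,
        Phi N f g (x (k+1)) +
          ((α k / 4 * (Metric.infDist (0 : Euc d)
              {v : Euc d | ∃ w ∈ Subdiff g (x (k+1)),
                v = gradient (fun y => ∑ i, f i y) (x (k+1)) + w}) ^ 2 +
            ‖x (k+1) - x k‖ ^ 2 / (8 * α k) : ℝ) : EReal) ≤
        Phi N f g (x k) +
          (((1/12) * ((N:ℝ) - 1) ^ 2 * N * (2 * N - 1) * L ^ 2 * M ^ 2 * α k ^ 3 : ℝ) :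
            EReal) := by
  obtain ⟨C, hC0, hC⟩ := exists_uniform_linear_decrease hgc hgp hgdom hglip hX
  have hN' : (1:ℝ) ≤ N := by exact_mod_cast hN
  have hL0 : 0 ≤ L := by linarith
  have hM0 : 0 ≤ M := by linarith
  have hden : 0 < 2 * (N * L) + 2 * C + 8 * (N * M) := by positivity
  refine ⟨1 / (2 * (N * L) + 2 * C + 8 * (N * M)), by positivity, ?_⟩
  intro K x α σ z hxX hα hz0 hz hprox k hk
  specialize hxX k hk
  obtain ⟨ha, haub⟩ := hα k hk
  specialize hz0 k hk
  specialize hz k hk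
  specialize hprox k hk
  generalize α k = a at *
  rw [le_div_iff₀ hden] at haub
  have hNL : 0 ≤ a * (N * L) := by positivity
  have hNM : 0 ≤ a * (N * M) := by positivity
  have hCa : 0 ≤ a * C := by positivity
  have haL : a * (N * L) ≤ 1 := by nlinarith
  have haM : a * (N * M) ≤ 1 / 8 := by nlinarith
  by_cases hgx : g (x k) = ⊤
  · rw [Phi, Phi, hgx, EReal.coe_add_top, EReal.top_add_coe]
    exact le_top
  have hgy : g (x (k + 1)) ≠ ⊤ := prox_ne_top hgp hprox
  have hF : ∀ i, ∀ y ∈ BallSet X 1, ‖gradient (f i) y‖ ≤ L := fun i _ hy =>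
    norm_gradient_le_of_lipschitz_near hL0 (hLf i) hy
  have hFM : ∀ i, ∀ y ∈ BallSet X 1, ∀ w ∈ BallSet X 1,
      ‖gradient (f i) y - gradient (f i) w‖ ≤ M * ‖y - w‖ := fun i y hy w hw =>
    hMf i y (subset_convexHull ℝ _ hy) w (subset_convexHull ℝ _ hw)
  have hz0X : z k 0 ∈ X := hz0 ▸ hxX
  have hdist := inner_iterate_dist_le (F := fun i => gradient (f (σ k i))) ha.le hL0 haL hz0X
    (fun i => hF _) hz le_rfl
  have herr := inner_loop_error_le (F := fun i => gradient (f (σ k i))) ha.le hL0 hM0 haL hz0X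
    (fun i => hF _) (fun i => hFM _) hz
  have hzN := inner_loop_eq (F := fun i => gradient (f (σ k i))) hz
  rw [hz0] at hdist herr hzN
  rw [Equiv.sum_comp (σ k) (fun i => gradient (f i) (x k))] at herr
  generalize (∑ i, gradient (f (σ k i)) (z k i.1)) = G at *
  have hxB : x k ∈ BallSet X 1 := ⟨x k, hxX, by simp⟩
  have hyB : x (k + 1) ∈ BallSet X 1 := by
    refine ⟨x k, hxX, (prox_displacement_le hgp ha hprox hgx hC0 (hC _ hxX hgx)).trans ?_⟩
    nlinarith
  have hsub := prox_mem_subdiff hgc hgp ha hprox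
  have hgdec := prox_subgradient_toReal hgc hgp ha hprox hgx
  have hp : a⁻¹ • (z k N - x (k + 1)) = -(a⁻¹ • (x (k + 1) - x k)) - G := by
    have e : z k N - x (k + 1) = -(x (k + 1) - x k) - a • G := by
      rw [sub_eq_iff_eq_add.1 hzN]; abel
    rw [e, smul_sub, inv_smul_smul₀ ha.ne', smul_neg]
  have hfdec : ∑ i, f i (x (k + 1)) ≤ ∑ i, f i (x k) +
      ⟪∑ i, gradient (f i) (x k), x (k + 1) - x k⟫ + N * M * ‖x (k + 1) - x k‖ ^ 2 := by
    have h := Finset.sum_le_sum fun i (_ : i ∈ Finset.univ) =>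
      le_add_inner_gradient (hdiff i) (convex_convexHull ℝ _) hM0 (hMf i)
        (subset_convexHull ℝ _ hxB) (subset_convexHull ℝ _ hyB)
    rw [Finset.sum_add_distrib, Finset.sum_add_distrib, ← sum_inner, Finset.sum_const,
      Finset.card_univ, Fintype.card_fin, nsmul_eq_mul, ← mul_assoc] at h
    exact h
  have hD : ‖∑ i, gradient (f i) (x (k + 1)) - ∑ i, gradient (f i) (x k)‖ ≤
      N * M * ‖x (k + 1) - x k‖ := by
    rw [← Finset.sum_sub_distrib]
    refine (norm_sum_le_of_le _ fun i _ => hFM i _ hyB _ hxB).trans_eq ?_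
    simp [mul_assoc]
  have hquad := quadratic_descent_bound (E := ∑ i, gradient (f i) (x k) - G) ha haM hD
  have hinf : Metric.infDist (0 : Euc d) {v : Euc d | ∃ w ∈ Subdiff g (x (k + 1)),
      v = gradient (fun y => ∑ i, f i y) (x (k + 1)) + w} ^ 2 ≤
      ‖-(a⁻¹ • (x (k + 1) - x k)) + (∑ i, gradient (f i) (x k) - G) +
        (∑ i, gradient (f i) (x (k + 1)) - ∑ i, gradient (f i) (x k))‖ ^ 2 := by
    refine pow_le_pow_left₀ Metric.infDist_nonneg ?_ 2
    have h := Metric.infDist_le_dist_of_mem (x := (0 : Euc d))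
      (s := {v : Euc d | ∃ w ∈ Subdiff g (x (k + 1)),
        v = gradient (fun y => ∑ i, f i y) (x (k + 1)) + w}) ⟨_, hsub, rfl⟩
    refine h.trans_eq ?_
    rw [dist_zero_left, gradient_fun_sum hdiff, hp]
    refine congrArg _ ?_
    abel
  have hfin := half_sq_error_le hN ha.le (norm_nonneg _) herr
  have hinner : ⟪a⁻¹ • (z k N - x (k + 1)), x k - x (k + 1)⟫ =
      ‖x (k + 1) - x k‖ ^ 2 / a + ⟪G, x (k + 1) - x k⟫ := by
    rw [hp, ← neg_sub (x (k + 1)) (x k), inner_neg_right, inner_sub_left, inner_neg_left,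
      real_inner_smul_left, real_inner_self_eq_norm_sq]
    ring
  rw [hinner] at hgdec
  rw [inner_sub_left] at hquad
  have hinf' := mul_le_mul_of_nonneg_left hinf (by positivity : 0 ≤ a / 4)
  rw [Phi, Phi, ← coe_toReal_of_proper hgp hgx, ← coe_toReal_of_proper hgp hgy]
  simp only [← EReal.coe_add]
  rw [EReal.coe_le_coe_iff]
  linarith
end
end

section
/- (Conservation law for ℓ_p nonnegative matrix factorization flow) Let p ≥ 1, M ∈ ℝ^{m×n}, and let (X, Y) : [0,∞) → ℝ^{m×r} × ℝ^{n×r} be absolutely continuous with derivatives (U, V), with X(t) and Y(t) entrywise nonnegative for all t, such that for almost every t ≥ 0 there exists Λ(t) ∈ ℝ^{m×n} with Λ_{ij}(t) ∈ sign((X(t)Y(t)ᵀ − M)_{ij}) for all i,j, and, setting E(t) := −Λ(t) ⊙ |X(t)Y(t)ᵀ − M|^{∘(p−1)} (entrywise product with the matrix of (p−1)-st powers of absolute values, with convention 0⁰ = 1): U_{ik}(t) = (E(t)Y(t))_{ik} if X_{ik}(t) > 0 and U_{ik}(t) = max((E(t)Y(t))_{ik}, 0) if X_{ik}(t) = 0;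 and V_{jk}(t) = (E(t)ᵀX(t))_{jk} if Y_{jk}(t) > 0 and V_{jk}(t) = max((E(t)ᵀX(t))_{jk}, 0) if Y_{jk}(t) = 0. Then for every k ∈ {1,…,r} and every t ≥ 0: Σ_{i=1}^m X_{ik}(t)² − Σ_{j=1}^n Y_{jk}(t)² = Σ_{i=1}^m X_{ik}(0)² − Σ_{j=1}^n Y_{jk}(0)². -/
open MeasureTheory Matrix

noncomputable section

/-- The set-valued sign map: `{−1}` for negative, `[−1,1]` at `0`, `{1}` for positive. -/
def signSet (s : ℝ) : Set ℝ :=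
  if s < 0 then {-1} else if 0 < s then {1} else Set.Icc (-1) 1

/-- The matrix `E = −Λ ⊙ |XYᵀ − M|^{∘(p−1)}` (entrywise, real powers, `0⁰ = 1`). -/
def Emat {m n r : ℕ} (p : ℝ) (M : Matrix (Fin m) (Fin n) ℝ)
    (X : Matrix (Fin m) (Fin r) ℝ) (Y : Matrix (Fin n) (Fin r) ℝ)
    (Λ : Matrix (Fin m) (Fin n) ℝ) : Matrix (Fin m) (Fin n) ℝ :=
  Matrix.of fun i j => -(Λ i j) * |(X * Yᵀ - M) i j| ^ (p - 1)

/-- `(X, Y)` with derivatives `(U, V)` is a solution of the projected subgradient flow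
of `(X,Y) ↦ (1/p)‖XYᵀ − M‖_p^p` over the nonnegative orthant. -/
def IsNMFFlow {m n r : ℕ} (p : ℝ) (M : Matrix (Fin m) (Fin n) ℝ)
    (X U : ℝ → Matrix (Fin m) (Fin r) ℝ) (Y V : ℝ → Matrix (Fin n) (Fin r) ℝ) : Prop :=
  (∀ i k, ∀ T ≥ (0:ℝ), IntervalIntegrable (fun s => U s i k) volume 0 T) ∧
  (∀ j k, ∀ T ≥ (0:ℝ), IntervalIntegrable (fun s => V s j k) volume 0 T) ∧
  (∀ t ≥ (0:ℝ), ∀ i k, X t i k = X 0 i k + ∫ s in (0:ℝ)..t, U s i k) ∧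
  (∀ t ≥ (0:ℝ), ∀ j k, Y t j k = Y 0 j k + ∫ s in (0:ℝ)..t, V s j k) ∧
  (∀ t ≥ (0:ℝ), ∀ i k, 0 ≤ X t i k) ∧
  (∀ t ≥ (0:ℝ), ∀ j k, 0 ≤ Y t j k) ∧
  (∀ᵐ t ∂volume, 0 ≤ t → ∃ Λ : Matrix (Fin m) (Fin n) ℝ,
    (∀ i j, Λ i j ∈ signSet ((X t * (Y t)ᵀ - M) i j)) ∧
    (∀ i k,
      (0 < X t i k → U t i k = (Emat p M (X t) (Y t) Λ * Y t) i k) ∧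
      (X t i k = 0 → U t i k = max ((Emat p M (X t) (Y t) Λ * Y t) i k) 0)) ∧
    (∀ j k,
      (0 < Y t j k → V t j k = ((Emat p M (X t) (Y t) Λ)ᵀ * X t) j k) ∧
      (Y t j k = 0 → V t j k = max (((Emat p M (X t) (Y t) Λ)ᵀ * X t) j k) 0)))

/-- The energy identity `x(T)² − x(0)² = 2 ∫ x u` for the primitive `x` of an integrable `u`. -/
theorem integral_primitive_mul {x u : ℝ → ℝ} {T : ℝ} (hT : 0 ≤ T)
    (hu : IntervalIntegrable u volume 0 T)
    (hx : ∀ t ≥ (0:ℝ), x t = x 0 + ∫ s in (0:ℝ)..t, u s) :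
    IntervalIntegrable (fun s => x s * u s) volume 0 T ∧
      ∫ s in (0:ℝ)..T, x s * u s = (x T ^ 2 - x 0 ^ 2) / 2 := by
  set F : ℝ → ℝ := fun t => x 0 + ∫ s in (0:ℝ)..t, u s with hF
  have hF_ac : AbsolutelyContinuousOnInterval F 0 T :=
    ((LipschitzWith.const (x 0)).lipschitzOnWith.absolutelyContinuousOnInterval).fun_add
      (hu.absolutelyContinuousOnInterval_intervalIntegral Set.left_mem_uIcc)
  have hFx : ∀ s ∈ Set.uIoc 0 T, F s = x s := fun s hs => by
    rw [Set.uIoc_of_le hT] at hs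
    exact (hx s hs.1.le).symm
  have hint : IntervalIntegrable (fun s => x s * u s) volume 0 T :=
    (hu.continuousOn_mul hF_ac.continuousOn).congr fun s hs => by simp only [hFx s hs]
  refine ⟨hint, ?_⟩
  have hparts := hF_ac.integral_deriv_mul_eq_sub hF_ac
  have hderiv : ∫ s in (0:ℝ)..T, (deriv F s * F s + F s * deriv F s) =
      ∫ s in (0:ℝ)..T, 2 * (x s * u s) := by
    apply intervalIntegral.integral_congr_ae
    filter_upwards [hu.ae_hasDerivAt_integral] with s hs hmem
    have hd : deriv F s = u s :=
      ((hs (Set.uIoc_subset_uIcc hmem) 0 Set.left_mem_uIcc).const_add (x 0)).deriv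
    rw [hd, hFx s hmem]
    ring
  rw [hderiv, intervalIntegral.integral_const_mul] at hparts
  have hF0 : F 0 = x 0 := by simp [hF]
  have hFT : F T = x T := (hx T hT).symm
  rw [hF0, hFT] at hparts
  linarith

/-- Complementarity: the projection onto the tangent cone of `[0,∞)` does not change the
product with the base point. -/
theorem mul_tangentProj_eq {x u g : ℝ} (hx : 0 ≤ x) (hpos : 0 < x → u = g) :
    x * u = x * g := by
  rcases hx.eq_or_lt with rfl | h
  · simp
  · rw [hpos h]

theorem sum_mul_mul_apply_eq {m n r : ℕ} (E : Matrix (Fin m) (Fin n) ℝ)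
    (X : Matrix (Fin m) (Fin r) ℝ) (Y : Matrix (Fin n) (Fin r) ℝ) (k : Fin r) :
    ∑ i, X i k * (E * Y) i k = ∑ j, Y j k * (Eᵀ * X) j k := by
  simp only [Matrix.mul_apply, Matrix.transpose_apply, Finset.mul_sum]
  rw [Finset.sum_comm]
  exact Finset.sum_congr rfl fun j _ => Finset.sum_congr rfl fun i _ => by ring

/-- conservation law for the ℓ_p NMF flow: along any projected
subgradient flow trajectory, `Σ_i X_{ik}(t)² − Σ_j Y_{jk}(t)²` is constant in `t`. -/
theorem stmt16 {m n r : ℕ} (p : ℝ) (hp : 1 ≤ p) (M : Matrix (Fin m) (Fin n) ℝ)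
    (X U : ℝ → Matrix (Fin m) (Fin r) ℝ) (Y V : ℝ → Matrix (Fin n) (Fin r) ℝ)
    (hflow : IsNMFFlow p M X U Y V) :
    ∀ k : Fin r, ∀ t ≥ (0:ℝ),
      (∑ i, X t i k ^ 2) - (∑ j, Y t j k ^ 2) =
        (∑ i, X 0 i k ^ 2) - (∑ j, Y 0 j k ^ 2) := by
  obtain ⟨hU, hV, hX, hY, hX0, hY0, hae⟩ := hflow
  intro k t ht
  have hx i := integral_primitive_mul ht (hU i k t ht) fun s hs => hX s hs i k
  have hy j := integral_primitive_mul ht (hV j k t ht) fun s hs => hY s hs j k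
  have hbalance : ∫ s in (0:ℝ)..t, ∑ i, X s i k * U s i k =
      ∫ s in (0:ℝ)..t, ∑ j, Y s j k * V s j k := by
    apply intervalIntegral.integral_congr_ae
    filter_upwards [hae] with s hs hmem
    rw [Set.uIoc_of_le ht] at hmem
    have hs0 : 0 ≤ s := hmem.1.le
    obtain ⟨Λ, -, hUΛ, hVΛ⟩ := hs hs0
    simp only [mul_tangentProj_eq (hX0 s hs0 _ k) (hUΛ _ k).1,
      mul_tangentProj_eq (hY0 s hs0 _ k) (hVΛ _ k).1]
    exact sum_mul_mul_apply_eq _ _ _ k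
  rw [intervalIntegral.integral_finsetSum fun i _ => (hx i).1,
    intervalIntegral.integral_finsetSum fun j _ => (hy j).1] at hbalance
  simp only [(hx _).2, (hy _).2, ← Finset.sum_div, Finset.sum_sub_distrib] at hbalance
  linarith
end
end

section
/- Let p ≥ 1, M ∈ ℝ^{m×n}, and X₀ ∈ ℝ₊^{m×r}, Y₀ ∈ ℝ₊^{n×r}. There exists d > 0 such that every absolutely continuous (X, Y) : [0,∞) → ℝ^{m×r} × ℝ^{n×r} with X(0) = X₀, Y(0) = Y₀ that is a solution of the projected subgradient flow of (X,Y) ↦ (1/p)‖XYᵀ − M‖_p^p over the nonnegative orthant satisfies X_{ik}(t)·Y_{jk}(t) ≤ d for all t ≥ 0, all i ∈ {1,…,m}, j ∈ {1,…,n}, k ∈ {1,…,r}. -/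
open MeasureTheory Matrix

noncomputable section

open Set Filter Topology

theorem locallyLipschitz_abs_rpow {p : ℝ} (hp : 1 ≤ p) :
    LocallyLipschitz fun x : ℝ => |x| ^ p := by
  have h : ContDiff ℝ 1 fun x : ℝ => x ^ p :=
    Real.contDiff_rpow_const_of_le (n := 1) (by exact_mod_cast hp)
  have habs : LipschitzWith 1 fun x : ℝ => |x| := lipschitzWith_one_norm
  exact h.locallyLipschitz.comp habs.locallyLipschitz

namespace AbsolutelyContinuousOnInterval

theorem congr {X : Type*} [PseudoMetricSpace X] {f g : ℝ → X} {a b : ℝ}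
    (hf : AbsolutelyContinuousOnInterval f a b) (hfg : EqOn f g (uIcc a b)) :
    AbsolutelyContinuousOnInterval g a b := by
  rw [absolutelyContinuousOnInterval_iff] at hf ⊢
  intro ε hε
  obtain ⟨δ, hδ, h⟩ := hf ε hε
  refine ⟨δ, hδ, fun E hE hlen => ?_⟩
  refine lt_of_eq_of_lt (Finset.sum_congr rfl fun i hi => ?_) (h E hE hlen)
  rw [hfg (hE.1 i hi).1, hfg (hE.1 i hi).2]

theorem sum {ι F : Type*} [SeminormedAddCommGroup F] {f : ι → ℝ → F} {a b : ℝ} (s : Finset ι)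
    (hf : ∀ i ∈ s, AbsolutelyContinuousOnInterval (f i) a b) :
    AbsolutelyContinuousOnInterval (fun t => ∑ i ∈ s, f i t) a b := by
  classical
  induction s using Finset.induction_on with
  | empty =>
    exact (LipschitzWith.const (0 : F)).lipschitzOnWith.absolutelyContinuousOnInterval
  | insert i s hi ih =>
    simp only [Finset.sum_insert hi]
    exact (hf i (by simp)).fun_add (ih fun j hj => hf j (by simp [hj]))

theorem locallyLipschitz_comp {Y : Type*} [PseudoMetricSpace Y]
    {φ : ℝ → Y} {f : ℝ → ℝ} {a b : ℝ}
    (hφ : LocallyLipschitz φ) (hf : AbsolutelyContinuousOnInterval f a b) :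
    AbsolutelyContinuousOnInterval (fun t => φ (f t)) a b := by
  obtain ⟨K, hK⟩ := (hφ.locallyLipschitzOn (s := f '' uIcc a b)).exists_lipschitzOnWith_of_compact
    (isCompact_uIcc.image_of_continuousOn hf.continuousOn)
  rw [absolutelyContinuousOnInterval_iff] at hf ⊢
  intro ε hε
  obtain ⟨δ, hδ, h⟩ := hf (ε / (K + 1)) (by positivity)
  refine ⟨δ, hδ, fun E hE hlen => ?_⟩
  calc ∑ i ∈ Finset.range E.1, dist (φ (f (E.2 i).1)) (φ (f (E.2 i).2))
      ≤ ∑ i ∈ Finset.range E.1, K * dist (f (E.2 i).1) (f (E.2 i).2) :=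
        Finset.sum_le_sum fun i hi => hK.dist_le_mul _ (mem_image_of_mem f (hE.1 i hi).1) _
          (mem_image_of_mem f (hE.1 i hi).2)
    _ = K * ∑ i ∈ Finset.range E.1, dist (f (E.2 i).1) (f (E.2 i).2) := by rw [Finset.mul_sum]
    _ ≤ (K + 1) * ∑ i ∈ Finset.range E.1, dist (f (E.2 i).1) (f (E.2 i).2) := by
        gcongr
        linarith
    _ < (K + 1) * (ε / (K + 1)) := by
        have := h E hE hlen
        gcongr
    _ = ε := by field_simp

theorem le_of_ae_deriv_nonpos {f : ℝ → ℝ} {a b : ℝ} (hab : a ≤ b)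
    (hf : AbsolutelyContinuousOnInterval f a b)
    (hderiv : ∀ᵐ t, t ∈ Ioo a b → deriv f t ≤ 0) : f b ≤ f a := by
  have h : ∫ t in a..b, deriv f t ≤ 0 := by
    rw [intervalIntegral.integral_of_le hab, integral_Ioc_eq_integral_Ioo]
    exact setIntegral_nonpos_of_ae_restrict ((ae_restrict_iff' measurableSet_Ioo).2 hderiv)
  rw [hf.integral_deriv_eq_sub] at h
  linarith

end AbsolutelyContinuousOnInterval

theorem HasDerivAt.eq_zero_of_differentiableAt_abs {g : ℝ → ℝ} {g' t : ℝ}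
    (hg : HasDerivAt g g' t) (h0 : g t = 0) (hd : DifferentiableAt ℝ (fun s => |g s|) t) :
    g' = 0 := by
  have hmin : IsLocalMin (fun s => |g s|) t := Eventually.of_forall fun s => by simp [h0]
  have h1 : HasDerivAt (fun s => |g s|) 0 t := hmin.deriv_eq_zero ▸ hd.hasDerivAt
  have h2 : HasDerivAt g 0 t := by
    rw [hasDerivAt_iff_isLittleO] at h1 ⊢
    simp only [h0, abs_zero, smul_zero, sub_zero] at h1 ⊢
    exact h1.of_abs_left
  exact hg.unique h2

theorem HasDerivAt.abs_rpow_of_mem_signSet {p : ℝ} (hp : 1 ≤ p) {g : ℝ → ℝ} {g' t l : ℝ}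
    (hg : HasDerivAt g g' t) (hd : DifferentiableAt ℝ (fun s => |g s| ^ p) t)
    (hl : l ∈ signSet (g t)) :
    HasDerivAt (fun s => |g s| ^ p) (p * (l * |g t| ^ (p - 1) * g')) t := by
  rcases lt_trichotomy (g t) 0 with h | h | h
  · have hl' : l = -1 := by simpa [signSet, h] using hl
    have h1 := ((hasDerivAt_abs_neg h).comp t hg).rpow_const (p := p) (Or.inr hp)
    convert! h1 using 1
    simp [hl']
    ring
  · have hmin : IsLocalMin (fun s => |g s| ^ p) t := Eventually.of_forall fun s => by
      simp only [h, abs_zero]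
      rw [Real.zero_rpow (by linarith)]
      positivity
    have h1 : HasDerivAt (fun s => |g s| ^ p) 0 t := hmin.deriv_eq_zero ▸ hd.hasDerivAt
    convert h1 using 1
    rcases hp.eq_or_lt with rfl | hp
    · simp only [Real.rpow_one] at hd
      simp [hg.eq_zero_of_differentiableAt_abs h hd]
    · simp [h, Real.zero_rpow (sub_pos.2 hp).ne']
  · have hl' : l = 1 := by simpa [signSet, h, h.not_gt] using hl
    have h1 := ((hasDerivAt_abs_pos h).comp t hg).rpow_const (p := p) (Or.inr hp)
    convert! h1 using 1
    simp [hl']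
    ring

section Primitive

variable {x u : ℝ → ℝ} {T : ℝ}

theorem absolutelyContinuousOnInterval_of_eq_integral (hT : 0 ≤ T)
    (hu : IntervalIntegrable u volume 0 T)
    (hx : ∀ t ≥ 0, x t = x 0 + ∫ s in (0 : ℝ)..t, u s) :
    AbsolutelyContinuousOnInterval x 0 T := by
  have hc : AbsolutelyContinuousOnInterval (fun _ : ℝ => x 0) 0 T :=
    (LipschitzWith.const (x 0)).lipschitzOnWith.absolutelyContinuousOnInterval
  refine (hc.fun_add
    (hu.absolutelyContinuousOnInterval_intervalIntegral left_mem_uIcc)).congr fun t ht => ?_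
  rw [uIcc_of_le hT] at ht
  exact (hx t ht.1).symm

theorem ae_hasDerivAt_of_eq_integral (hu : IntervalIntegrable u volume 0 T)
    (hx : ∀ t ≥ 0, x t = x 0 + ∫ s in (0 : ℝ)..t, u s) :
    ∀ᵐ t, t ∈ Ioo 0 T → HasDerivAt x (u t) t := by
  filter_upwards [hu.ae_hasDerivAt_integral] with t ht htT
  have h := (ht (Icc_subset_uIcc (Ioo_subset_Icc_self htT)) 0 left_mem_uIcc).const_add (x 0)
  refine h.congr_of_eventuallyEq ?_
  filter_upwards [Ioi_mem_nhds htT.1] with s hs using hx s (le_of_lt hs)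

end Primitive

theorem HasDerivAt.mul_nonneg_of_projected {x : ℝ → ℝ} {u e t : ℝ} (ht : 0 < t)
    (hx : HasDerivAt x u t) (hnn : ∀ s ≥ 0, 0 ≤ x s) (hu : 0 < x t → u = e) : 0 ≤ u * e := by
  rcases (hnn t ht.le).eq_or_lt with h | h
  · have hmin : IsLocalMin x t := by
      filter_upwards [Ioi_mem_nhds ht] with s hs
      rw [← h]
      exact hnn s (le_of_lt hs)
    simp [hmin.hasDerivAt_eq_zero hx]
  · rw [hu h]
    exact mul_self_nonneg e

theorem sum_mul_product_rule {m n r : ℕ} (E : Matrix (Fin m) (Fin n) ℝ)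
    (X U : Matrix (Fin m) (Fin r) ℝ) (Y V : Matrix (Fin n) (Fin r) ℝ) :
    ∑ i, ∑ j, E i j * ∑ k, (U i k * Y j k + X i k * V j k) =
      ∑ i, ∑ k, U i k * (E * Y) i k + ∑ j, ∑ k, V j k * (Eᵀ * X) j k := by
  simp only [Finset.sum_add_distrib, mul_add, Matrix.mul_apply, Matrix.transpose_apply,
    Finset.mul_sum]
  congr 1
  · refine Finset.sum_congr rfl fun i _ => ?_
    rw [Finset.sum_comm]
    exact Finset.sum_congr rfl fun k _ => Finset.sum_congr rfl fun j _ => by ring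
  · rw [Finset.sum_comm]
    refine Finset.sum_congr rfl fun j _ => ?_
    rw [Finset.sum_comm]
    exact Finset.sum_congr rfl fun k _ => Finset.sum_congr rfl fun i _ => by ring

namespace IsNMFFlow

variable {m n r : ℕ} {p : ℝ} {M : Matrix (Fin m) (Fin n) ℝ}
  {X U : ℝ → Matrix (Fin m) (Fin r) ℝ} {Y V : ℝ → Matrix (Fin n) (Fin r) ℝ}

theorem absolutelyContinuousOnInterval_residual (h : IsNMFFlow p M X U Y V) {T : ℝ} (hT : 0 ≤ T)
    (i : Fin m) (j : Fin n) :
    AbsolutelyContinuousOnInterval (fun t => (X t * (Y t)ᵀ - M) i j) 0 T := by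
  obtain ⟨hU, hV, hX, hY, -⟩ := h
  simp only [Matrix.sub_apply, Matrix.mul_apply, Matrix.transpose_apply]
  refine AbsolutelyContinuousOnInterval.fun_sub
    (AbsolutelyContinuousOnInterval.sum _ fun k _ => AbsolutelyContinuousOnInterval.fun_mul ?_ ?_)
    (LipschitzWith.const (M i j)).lipschitzOnWith.absolutelyContinuousOnInterval
  · exact absolutelyContinuousOnInterval_of_eq_integral hT (hU i k T hT) fun t ht => hX t ht i k
  · exact absolutelyContinuousOnInterval_of_eq_integral hT (hV j k T hT) fun t ht => hY t ht j k

theorem sum_abs_residual_rpow_le (hp : 1 ≤ p) (h : IsNMFFlow p M X U Y V) {T : ℝ} (hT : 0 ≤ T) :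
    ∑ i, ∑ j, |(X T * (Y T)ᵀ - M) i j| ^ p ≤ ∑ i, ∑ j, |(X 0 * (Y 0)ᵀ - M) i j| ^ p := by
  have hac (i : Fin m) (j : Fin n) := AbsolutelyContinuousOnInterval.locallyLipschitz_comp
    (locallyLipschitz_abs_rpow hp) (h.absolutelyContinuousOnInterval_residual hT i j)
  obtain ⟨hU, hV, hX, hY, hXnn, hYnn, hflow⟩ := h
  refine AbsolutelyContinuousOnInterval.le_of_ae_deriv_nonpos hT
    (f := fun t => ∑ i, ∑ j, |(X t * (Y t)ᵀ - M) i j| ^ p)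
    (AbsolutelyContinuousOnInterval.sum _ fun i _ =>
      AbsolutelyContinuousOnInterval.sum _ fun j _ => hac i j) ?_
  have hdX : ∀ᵐ t, ∀ i k, t ∈ Ioo 0 T → HasDerivAt (fun s => X s i k) (U t i k) t :=
    ae_all_iff.2 fun i => ae_all_iff.2 fun k =>
      ae_hasDerivAt_of_eq_integral (hU i k T hT) fun t ht => hX t ht i k
  have hdY : ∀ᵐ t, ∀ j k, t ∈ Ioo 0 T → HasDerivAt (fun s => Y s j k) (V t j k) t :=
    ae_all_iff.2 fun j => ae_all_iff.2 fun k =>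
      ae_hasDerivAt_of_eq_integral (hV j k T hT) fun t ht => hY t ht j k
  have hdiff : ∀ᵐ t, ∀ i j, t ∈ uIcc 0 T →
      DifferentiableAt ℝ (fun s => |(X s * (Y s)ᵀ - M) i j| ^ p) t :=
    ae_all_iff.2 fun i => ae_all_iff.2 fun j => (hac i j).ae_differentiableAt
  filter_upwards [hdX, hdY, hdiff, hflow] with t hdX hdY hdiff hflow ht
  obtain ⟨Λ, hΛ, hflowX, hflowY⟩ := hflow ht.1.le
  have hres (i : Fin m) (j : Fin n) : HasDerivAt (fun s => (X s * (Y s)ᵀ - M) i j)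
      (∑ k, (U t i k * Y t j k + X t i k * V t j k)) t := by
    simp only [Matrix.sub_apply, Matrix.mul_apply, Matrix.transpose_apply]
    exact (HasDerivAt.fun_sum fun k _ => (hdX i k ht).fun_mul (hdY j k ht)).sub_const _
  have hderiv := HasDerivAt.fun_sum (u := Finset.univ) fun i (_ : i ∈ Finset.univ) =>
    HasDerivAt.fun_sum (u := Finset.univ) fun j (_ : j ∈ Finset.univ) =>
      (hres i j).abs_rpow_of_mem_signSet hp
        (hdiff i j (Icc_subset_uIcc (Ioo_subset_Icc_self ht))) (hΛ i j)
  rw [hderiv.deriv]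
  have hsum := sum_mul_product_rule (Emat p M (X t) (Y t) Λ) (X t) (U t) (Y t) (V t)
  have hnn : 0 ≤ ∑ i, ∑ j, Emat p M (X t) (Y t) Λ i j *
      ∑ k, (U t i k * Y t j k + X t i k * V t j k) := by
    rw [hsum]
    refine add_nonneg ?_ ?_
    · exact Finset.sum_nonneg fun i _ => Finset.sum_nonneg fun k _ =>
        (hdX i k ht).mul_nonneg_of_projected ht.1 (fun s hs => hXnn s hs i k) (hflowX i k).1
    · exact Finset.sum_nonneg fun j _ => Finset.sum_nonneg fun k _ =>
        (hdY j k ht).mul_nonneg_of_projected ht.1 (fun s hs => hYnn s hs j k) (hflowY j k).1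
  simp only [Emat, Matrix.of_apply, neg_mul, Finset.sum_neg_distrib] at hnn
  simp only [← Finset.mul_sum] at hnn ⊢
  exact mul_nonpos_of_nonneg_of_nonpos (by linarith) (neg_nonneg.1 hnn)

end IsNMFFlow

/-- along any projected subgradient flow trajectory of ℓ_p NMF
started at a given nonnegative pair `(X₀, Y₀)`, all products `X_{ik}(t)·Y_{jk}(t)`
stay bounded by a constant `d` depending only on the data. -/
theorem stmt17 {m n r : ℕ} (p : ℝ) (hp : 1 ≤ p) (M : Matrix (Fin m) (Fin n) ℝ)
    (X₀ : Matrix (Fin m) (Fin r) ℝ) (Y₀ : Matrix (Fin n) (Fin r) ℝ)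
    (hX₀ : ∀ i k, 0 ≤ X₀ i k) (hY₀ : ∀ j k, 0 ≤ Y₀ j k) :
    ∃ d > (0:ℝ), ∀ (X U : ℝ → Matrix (Fin m) (Fin r) ℝ)
      (Y V : ℝ → Matrix (Fin n) (Fin r) ℝ),
      IsNMFFlow p M X U Y V → X 0 = X₀ → Y 0 = Y₀ →
      ∀ t ≥ (0:ℝ), ∀ (i : Fin m) (j : Fin n) (k : Fin r),
        X t i k * Y t j k ≤ d := by
  set C := ∑ i, ∑ j, |(X₀ * Y₀ᵀ - M) i j| ^ p with hC
  have hC0 : 0 ≤ C := by positivity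
  refine ⟨C ^ p⁻¹ + ∑ i, ∑ j, |M i j| + 1, by positivity, ?_⟩
  rintro X U Y V h rfl rfl t ht i j k
  have hle : |(X t * (Y t)ᵀ - M) i j| ^ p ≤ C :=
    calc |(X t * (Y t)ᵀ - M) i j| ^ p
        ≤ ∑ j, |(X t * (Y t)ᵀ - M) i j| ^ p :=
          Finset.single_le_sum (f := fun j => |(X t * (Y t)ᵀ - M) i j| ^ p)
            (fun _ _ => by positivity) (Finset.mem_univ j)
      _ ≤ ∑ i, ∑ j, |(X t * (Y t)ᵀ - M) i j| ^ p :=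
          Finset.single_le_sum (f := fun i => ∑ j, |(X t * (Y t)ᵀ - M) i j| ^ p)
            (fun _ _ => by positivity) (Finset.mem_univ i)
      _ ≤ C := h.sum_abs_residual_rpow_le hp ht
  have hres : (X t * (Y t)ᵀ) i j - M i j ≤ C ^ p⁻¹ :=
    (le_abs_self _).trans
      ((Real.le_rpow_inv_iff_of_pos (abs_nonneg _) hC0 (by linarith)).2 hle)
  have hM : M i j ≤ ∑ i, ∑ j, |M i j| :=
    calc M i j ≤ |M i j| := le_abs_self _
      _ ≤ ∑ j, |M i j| :=
          Finset.single_le_sum (f := fun j => |M i j|) (fun _ _ => abs_nonneg _)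
            (Finset.mem_univ j)
      _ ≤ ∑ i, ∑ j, |M i j| :=
          Finset.single_le_sum (f := fun i => ∑ j, |M i j|) (fun _ _ => by positivity)
            (Finset.mem_univ i)
  obtain ⟨-, -, -, -, hXnn, hYnn, -⟩ := h
  have hprod : X t i k * Y t j k ≤ (X t * (Y t)ᵀ) i j := by
    rw [Matrix.mul_apply]
    exact Finset.single_le_sum (f := fun k => X t i k * (Y t)ᵀ k j)
      (fun l _ => mul_nonneg (hXnn t ht i l) (hYnn t ht j l)) (Finset.mem_univ k)
  linarith
end
end

section
/- Let p ≥ 1, M ∈ ℝ^{m×n}, and X₀ ∈ ℝ₊^{m×r}, Y₀ ∈ ℝ₊^{n×r}. There exists R > 0 such that every absolutely continuous (X, Y) : [0,∞) → ℝ^{m×r} × ℝ^{n×r} with X(0) = X₀, Y(0) = Y₀ that is a solution of the projected subgradient flow of (X,Y) ↦ (1/p)‖XYᵀ − M‖_p^p over the nonnegative orthant satisfies ‖X(t)‖_F² + ‖Y(t)‖_F² ≤ R for all t ≥ 0; i.e. every such trajectory is bounded. -/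
open MeasureTheory Matrix

noncomputable section

/-- `f` is absolutely continuous on every `[0, T]`, with derivative `f'` almost everywhere on
`(0, ∞)`. -/
def HasACDeriv (f f' : ℝ → ℝ) : Prop :=
  (∀ T ≥ (0:ℝ), AbsolutelyContinuousOnInterval f 0 T) ∧
    ∀ᵐ t ∂volume, 0 < t → HasDerivAt f (f' t) t

namespace HasACDeriv

theorem of_eq_integral {f f' : ℝ → ℝ} (hint : ∀ T ≥ (0:ℝ), IntervalIntegrable f' volume 0 T)
    (hf : ∀ t ≥ (0:ℝ), f t = f 0 + ∫ s in (0:ℝ)..t, f' s) : HasACDeriv f f' := by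
  refine ⟨fun T hT => ?_, ?_⟩
  · have h := (hint T hT).absolutelyContinuousOnInterval_intervalIntegral
      (Set.left_mem_uIcc (a := (0:ℝ)) (b := T))
    rw [absolutelyContinuousOnInterval_iff] at h ⊢
    intro ε hε
    obtain ⟨δ, hδ, H⟩ := h ε hε
    refine ⟨δ, hδ, fun E hE hlt => ?_⟩
    convert H E hE hlt using 1
    refine Finset.sum_congr rfl fun i hi => ?_
    obtain ⟨h1, h2⟩ := hE.1 i hi
    rw [Set.uIcc_of_le hT] at h1 h2
    rw [hf _ h1.1, hf _ h2.1, dist_add_left]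
  · have h : ∀ᵐ t ∂volume, ∀ n : ℕ, t ∈ Set.uIcc (0:ℝ) n →
        ∀ c ∈ Set.uIcc (0:ℝ) n, HasDerivAt (fun x => ∫ s in c..x, f' s) (f' t) t :=
      ae_all_iff.2 fun n => (hint n n.cast_nonneg).ae_hasDerivAt_integral
    filter_upwards [h] with t ht h0
    obtain ⟨n, hn⟩ := exists_nat_ge t
    have := (ht n (Set.mem_uIcc_of_le h0.le hn) 0 Set.left_mem_uIcc).const_add (f 0)
    refine this.congr_of_eventuallyEq ?_
    filter_upwards [lt_mem_nhds h0] with s hs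
    exact hf s hs.le

theorem const (c : ℝ) : HasACDeriv (fun _ => c) (fun _ => 0) :=
  ⟨fun _ _ => (contDiff_const.contDiffOn).absolutelyContinuousOnInterval,
    .of_forall fun t _ => hasDerivAt_const t c⟩

theorem add {f f' g g' : ℝ → ℝ} (hf : HasACDeriv f f') (hg : HasACDeriv g g') :
    HasACDeriv (fun t => f t + g t) (fun t => f' t + g' t) := by
  refine ⟨fun T hT => (hf.1 T hT).add (hg.1 T hT), ?_⟩
  filter_upwards [hf.2, hg.2] with t h1 h2 h0
  exact (h1 h0).add (h2 h0)

theorem sub {f f' g g' : ℝ → ℝ} (hf : HasACDeriv f f') (hg : HasACDeriv g g') :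
    HasACDeriv (fun t => f t - g t) (fun t => f' t - g' t) := by
  refine ⟨fun T hT => (hf.1 T hT).sub (hg.1 T hT), ?_⟩
  filter_upwards [hf.2, hg.2] with t h1 h2 h0
  exact (h1 h0).sub (h2 h0)

theorem sq {f f' : ℝ → ℝ} (hf : HasACDeriv f f') :
    HasACDeriv (fun t => f t ^ 2) (fun t => 2 * (f t * f' t)) := by
  refine ⟨fun T hT => ?_, ?_⟩
  · convert (hf.1 T hT).mul (hf.1 T hT) using 1
    ext t
    exact pow_two _
  · filter_upwards [hf.2] with t h1 h0
    refine ((h1 h0).fun_pow 2).congr_deriv ?_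
    norm_num [mul_assoc]

theorem sum {ι : Type*} (s : Finset ι) {f f' : ι → ℝ → ℝ} (h : ∀ i, HasACDeriv (f i) (f' i)) :
    HasACDeriv (fun t => ∑ i ∈ s, f i t) (fun t => ∑ i ∈ s, f' i t) := by
  classical
  induction s using Finset.induction_on with
  | empty => simpa using const 0
  | insert a s ha ih => simpa [Finset.sum_insert ha] using (h a).add ih

theorem le_of_forall_gt_nonpos {f f' : ℝ → ℝ} (hf : HasACDeriv f f') {R : ℝ} (h0 : f 0 ≤ R)
    (hd : ∀ᵐ t ∂volume, 0 < t → R < f t → f' t ≤ 0) {t : ℝ} (ht : 0 ≤ t) : f t ≤ R := by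
  by_contra! hlt
  have hac := hf.1 t ht
  have hcont : ContinuousOn f (Set.Icc 0 t) := by
    simpa [Set.uIcc_of_le ht] using hac.continuousOn
  have hcl : IsClosed (Set.Icc 0 t ∩ f ⁻¹' Set.Iic R) :=
    hcont.preimage_isClosed_of_isClosed isClosed_Icc isClosed_Iic
  have hcomp : IsCompact (Set.Icc 0 t ∩ f ⁻¹' Set.Iic R) :=
    isCompact_Icc.of_isClosed_subset hcl Set.inter_subset_left
  obtain ⟨s, ⟨⟨hs0, hst⟩, hsR⟩, hmax⟩ := hcomp.exists_isGreatest ⟨0, ⟨le_rfl, ht⟩, h0⟩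
  have hgt : ∀ u, s < u → u ≤ t → R < f u := fun u hu hut => by
    by_contra! h
    exact absurd (hmax ⟨⟨hs0.trans hu.le, hut⟩, h⟩) (not_le.2 hu)
  have hac' : AbsolutelyContinuousOnInterval f s t :=
    hac.mono (by rw [Set.uIcc_of_le hst, Set.uIcc_of_le ht]; exact Set.Icc_subset_Icc_left hs0)
  have hle : ∫ u in s..t, deriv f u ≤ 0 := by
    rw [intervalIntegral.integral_of_le hst]
    refine integral_nonpos_of_ae ((ae_restrict_iff' measurableSet_Ioc).2 ?_)
    filter_upwards [hf.2, hd] with u h1 h2 hu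
    have hu0 : 0 < u := hs0.trans_lt hu.1
    rw [(h1 hu0).deriv]
    exact h2 hu0 (hgt u hu.1 hu.2)
  rw [hac'.integral_deriv_eq_sub] at hle
  exact absurd (show f s ≤ R from hsR) (by linarith)

theorem eq_of_ae_zero {f f' : ℝ → ℝ} (hf : HasACDeriv f f')
    (hd : ∀ᵐ t ∂volume, 0 < t → f' t = 0) {t : ℝ} (ht : 0 ≤ t) : f t = f 0 := by
  refine le_antisymm (hf.le_of_forall_gt_nonpos le_rfl ?_ ht) ?_
  · filter_upwards [hd] with u hu h0 _
    exact (hu h0).le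
  · have := ((const 0).sub hf).le_of_forall_gt_nonpos (R := 0 - f 0) le_rfl ?_ ht
    · linarith
    · filter_upwards [hd] with u hu h0 _
      simp [hu h0]

end HasACDeriv

theorem neg_mul_rpow_mul_le {p M A l : ℝ} (hp : 1 ≤ p) (hA : 0 ≤ A) (hl : l ∈ signSet (A - M)) :
    -l * |A - M| ^ (p - 1) * A ≤ |M| ^ (p - 1) * |M| := by
  have hpow : 0 ≤ |A - M| ^ (p - 1) := by positivity
  have hpow' : 0 ≤ |M| ^ (p - 1) := by positivity
  rcases lt_or_ge M A with h | h
  · have : l = 1 := by simpa [signSet, sub_pos.2 h, not_lt.2 h.le] using hl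
    subst this
    have := mul_nonneg hpow hA
    have := mul_nonneg hpow' (abs_nonneg M)
    linarith
  · have hl1 : -l ≤ 1 := by
      unfold signSet at hl
      split_ifs at hl
      · simp_all
      · simp_all
      · linarith [hl.1]
    have hAM : |A - M| ≤ |M| := by
      rw [abs_of_nonpos (by linarith), abs_of_nonneg (hA.trans h)]
      linarith
    have h1 : |A - M| ^ (p - 1) ≤ |M| ^ (p - 1) :=
      Real.rpow_le_rpow (abs_nonneg _) hAM (by linarith)
    calc -l * |A - M| ^ (p - 1) * A ≤ 1 * |A - M| ^ (p - 1) * A := by gcongr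
      _ ≤ |M| ^ (p - 1) * |M| := by
        rw [one_mul]
        exact mul_le_mul h1 (h.trans (le_abs_self M)) hA hpow'

theorem neg_mul_rpow_mul_le_neg {p M A l : ℝ} (hp : 1 ≤ p) (hA : |M| + 1 ≤ A)
    (hl : l ∈ signSet (A - M)) : -l * |A - M| ^ (p - 1) * A ≤ -A := by
  have h1 : 1 ≤ A - M := by linarith [le_abs_self M]
  have : l = 1 := by
    simpa [signSet, show M < A by linarith, show ¬ A < M by linarith] using hl
  subst this
  have h2 : 1 ≤ |A - M| ^ (p - 1) :=
    Real.one_le_rpow (h1.trans (le_abs_self _)) (by linarith)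
  nlinarith [abs_nonneg M]

theorem sum_Emat_mul_nonpos {m n r : ℕ} {p : ℝ} (hp : 1 ≤ p) {M Λ : Matrix (Fin m) (Fin n) ℝ}
    {X : Matrix (Fin m) (Fin r) ℝ} {Y : Matrix (Fin n) (Fin r) ℝ}
    (hX : ∀ i k, 0 ≤ X i k) (hY : ∀ j k, 0 ≤ Y j k)
    (hΛ : ∀ i j, Λ i j ∈ signSet ((X * Yᵀ - M) i j)) {i₀ : Fin m} {j₀ : Fin n}
    (h : (∑ i, ∑ j, |M i j|) + 1 + ∑ i, ∑ j, |M i j| ^ (p - 1) * |M i j| ≤ (X * Yᵀ) i₀ j₀) :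
    ∑ i, ∑ j, Emat p M X Y Λ i j * (X * Yᵀ) i j ≤ 0 := by
  set C := ∑ i, ∑ j, |M i j| ^ (p - 1) * |M i j| with hC
  have hA : ∀ i j, 0 ≤ (X * Yᵀ) i j := fun i j => by
    rw [Matrix.mul_apply]
    exact Finset.sum_nonneg fun k _ => mul_nonneg (hX i k) (hY j k)
  have hterm : ∀ i j, 0 ≤ |M i j| ^ (p - 1) * |M i j| := fun i j => by positivity
  have hC0 : 0 ≤ C := Finset.sum_nonneg fun i _ => Finset.sum_nonneg fun j _ => hterm i j
  have hM : |M i₀ j₀| ≤ ∑ i, ∑ j, |M i j| :=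
    (Finset.single_le_sum (f := fun j => |M i₀ j|) (fun j _ => abs_nonneg _)
      (Finset.mem_univ j₀)).trans
      (Finset.single_le_sum (f := fun i => ∑ j, |M i j|)
        (fun i _ => Finset.sum_nonneg fun j _ => abs_nonneg _) (Finset.mem_univ i₀))
  have key : ∀ i j, Emat p M X Y Λ i j * (X * Yᵀ) i j ≤
      |M i j| ^ (p - 1) * |M i j| - if i = i₀ then (if j = j₀ then C else 0) else 0 := by
    intro i j
    have hl := hΛ i j
    simp only [Emat, Matrix.of_apply]
    rw [Matrix.sub_apply] at hl ⊢
    by_cases hij : i = i₀ ∧ j = j₀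
    · obtain ⟨rfl, rfl⟩ := hij
      have := neg_mul_rpow_mul_le_neg hp (by linarith) hl
      have := hterm i j
      have := abs_nonneg (M i j)
      simp only [if_true]
      linarith
    · have := neg_mul_rpow_mul_le hp (hA i j) hl
      have h0 : (if i = i₀ then (if j = j₀ then C else 0) else 0) = 0 := by
        split_ifs <;> simp_all
      rw [h0]
      linarith
  calc ∑ i, ∑ j, Emat p M X Y Λ i j * (X * Yᵀ) i j
      ≤ ∑ i, ∑ j, (|M i j| ^ (p - 1) * |M i j| -
          if i = i₀ then (if j = j₀ then C else 0) else 0) :=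
        Finset.sum_le_sum fun i _ => Finset.sum_le_sum fun j _ => key i j
    _ = 0 := by
      simp only [Finset.sum_sub_distrib, ← hC]
      rw [Finset.sum_eq_single i₀ (fun i _ hi => by simp [hi]) (by simp)]
      simp

/-- If the product of two nonnegative matrices is entrywise bounded, their norms are controlled by
the imbalances of their columns. -/
theorem sum_sq_add_sum_sq_le {m n r : ℕ} {X : Matrix (Fin m) (Fin r) ℝ}
    {Y : Matrix (Fin n) (Fin r) ℝ} (hX : ∀ i k, 0 ≤ X i k) (hY : ∀ j k, 0 ≤ Y j k) {K : ℝ}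
    (hK : ∀ i j, (X * Yᵀ) i j ≤ K) :
    (∑ i, ∑ k, X i k ^ 2) + (∑ j, ∑ k, Y j k ^ 2) ≤
      ∑ k, (1 + ((∑ i, X i k ^ 2) - ∑ j, Y j k ^ 2) ^ 2 + 4 * (m * (n * K ^ 2))) := by
  rw [Finset.sum_comm, Finset.sum_comm (f := fun j k => Y j k ^ 2), ← Finset.sum_add_distrib]
  refine Finset.sum_le_sum fun k _ => ?_
  have hab : (∑ i, X i k ^ 2) * (∑ j, Y j k ^ 2) ≤ m * (n * K ^ 2) := by
    rw [Finset.sum_mul_sum]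
    calc ∑ i, ∑ j, X i k ^ 2 * Y j k ^ 2 ≤ ∑ _i : Fin m, ∑ _j : Fin n, K ^ 2 := by
          refine Finset.sum_le_sum fun i _ => Finset.sum_le_sum fun j _ => ?_
          rw [← mul_pow]
          refine pow_le_pow_left₀ (mul_nonneg (hX i k) (hY j k)) (le_trans ?_ (hK i j)) 2
          rw [Matrix.mul_apply]
          exact Finset.single_le_sum (f := fun k => X i k * Yᵀ k j)
            (fun k _ => mul_nonneg (hX i k) (hY j k)) (Finset.mem_univ k)
      _ = m * (n * K ^ 2) := by simp
  nlinarith [sq_nonneg ((∑ i, X i k ^ 2) + (∑ j, Y j k ^ 2) - 1)]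

namespace IsNMFFlow

variable {m n r : ℕ} {p : ℝ} {M : Matrix (Fin m) (Fin n) ℝ}
  {X U : ℝ → Matrix (Fin m) (Fin r) ℝ} {Y V : ℝ → Matrix (Fin n) (Fin r) ℝ}

theorem hasACDeriv_left (h : IsNMFFlow p M X U Y V) (i : Fin m) (k : Fin r) :
    HasACDeriv (fun t => X t i k) (fun t => U t i k) :=
  .of_eq_integral (h.1 i k) fun t ht => h.2.2.1 t ht i k

theorem hasACDeriv_right (h : IsNMFFlow p M X U Y V) (j : Fin n) (k : Fin r) :
    HasACDeriv (fun t => Y t j k) (fun t => V t j k) :=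
  .of_eq_integral (h.2.1 j k) fun t ht => h.2.2.2.1 t ht j k

theorem ae_sum_mul_eq (h : IsNMFFlow p M X U Y V) :
    ∀ᵐ t ∂volume, 0 < t → ∃ Λ : Matrix (Fin m) (Fin n) ℝ,
      (∀ i j, Λ i j ∈ signSet ((X t * (Y t)ᵀ - M) i j)) ∧
      (∀ k, ∑ i, X t i k * U t i k =
        ∑ i, ∑ j, Emat p M (X t) (Y t) Λ i j * (X t i k * Y t j k)) ∧
      (∀ k, ∑ j, Y t j k * V t j k =
        ∑ i, ∑ j, Emat p M (X t) (Y t) Λ i j * (X t i k * Y t j k)) := by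
  obtain ⟨-, -, -, -, hX, hY, hae⟩ := h
  filter_upwards [hae] with t ht h0
  obtain ⟨Λ, hΛ, hU, hV⟩ := ht h0.le
  refine ⟨Λ, hΛ, fun k => Finset.sum_congr rfl fun i _ => ?_, fun k => ?_⟩
  · have : X t i k * U t i k = X t i k * (Emat p M (X t) (Y t) Λ * Y t) i k := by
      rcases (hX t h0.le i k).eq_or_lt with h | h
      · simp [← h]
      · rw [(hU i k).1 h]
    rw [this, Matrix.mul_apply, Finset.mul_sum]
    exact Finset.sum_congr rfl fun j _ => by ring
  · rw [Finset.sum_comm]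
    refine Finset.sum_congr rfl fun j _ => ?_
    have : Y t j k * V t j k = Y t j k * ((Emat p M (X t) (Y t) Λ)ᵀ * X t) j k := by
      rcases (hY t h0.le j k).eq_or_lt with h | h
      · simp [← h]
      · rw [(hV j k).1 h]
    rw [this, Matrix.mul_apply, Finset.mul_sum]
    exact Finset.sum_congr rfl fun i _ => by rw [Matrix.transpose_apply]; ring

/-- The difference of the squared norms of matching columns is conserved along the flow. -/
theorem sum_sq_sub_sum_sq_eq (h : IsNMFFlow p M X U Y V) (k : Fin r) {t : ℝ} (ht : 0 ≤ t) :
    (∑ i, X t i k ^ 2) - ∑ j, Y t j k ^ 2 = (∑ i, X 0 i k ^ 2) - ∑ j, Y 0 j k ^ 2 := by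
  have hd := (HasACDeriv.sum Finset.univ fun i => (h.hasACDeriv_left i k).sq).sub
    (HasACDeriv.sum Finset.univ fun j => (h.hasACDeriv_right j k).sq)
  refine hd.eq_of_ae_zero ?_ ht
  filter_upwards [h.ae_sum_mul_eq] with s hs h0
  obtain ⟨Λ, -, hU, hV⟩ := hs h0
  rw [← Finset.mul_sum, ← Finset.mul_sum, hU, hV, sub_self]

end IsNMFFlow

/-- every projected subgradient flow trajectory of ℓ_p NMF started
at a given nonnegative pair `(X₀, Y₀)` is bounded:
`‖X(t)‖_F² + ‖Y(t)‖_F² ≤ R` for all `t ≥ 0`. -/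
theorem stmt18 {m n r : ℕ} (p : ℝ) (hp : 1 ≤ p) (M : Matrix (Fin m) (Fin n) ℝ)
    (X₀ : Matrix (Fin m) (Fin r) ℝ) (Y₀ : Matrix (Fin n) (Fin r) ℝ)
    (hX₀ : ∀ i k, 0 ≤ X₀ i k) (hY₀ : ∀ j k, 0 ≤ Y₀ j k) :
    ∃ R > (0:ℝ), ∀ (X U : ℝ → Matrix (Fin m) (Fin r) ℝ)
      (Y V : ℝ → Matrix (Fin n) (Fin r) ℝ),
      IsNMFFlow p M X U Y V → X 0 = X₀ → Y 0 = Y₀ →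
      ∀ t ≥ (0:ℝ),
        (∑ i, ∑ k, X t i k ^ 2) + (∑ j, ∑ k, Y t j k ^ 2) ≤ R := by
  set K := (∑ i, ∑ j, |M i j|) + 1 + ∑ i, ∑ j, |M i j| ^ (p - 1) * |M i j| with hK
  set N₀ := (∑ i, ∑ k, X₀ i k ^ 2) + (∑ j, ∑ k, Y₀ j k ^ 2) with hN₀
  set B := ∑ k, (1 + ((∑ i, X₀ i k ^ 2) - ∑ j, Y₀ j k ^ 2) ^ 2 + 4 * (m * (n * K ^ 2))) with hB
  have hN₀_nonneg : 0 ≤ N₀ := by positivity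
  have hB_nonneg : 0 ≤ B := by positivity
  refine ⟨1 + N₀ + B, by positivity, ?_⟩
  rintro X U Y V h rfl rfl t ht
  have hd := (HasACDeriv.sum Finset.univ fun i =>
      HasACDeriv.sum Finset.univ fun k => (h.hasACDeriv_left i k).sq).add
    (HasACDeriv.sum Finset.univ fun j =>
      HasACDeriv.sum Finset.univ fun k => (h.hasACDeriv_right j k).sq)
  refine hd.le_of_forall_gt_nonpos (by linarith) ?_ ht
  filter_upwards [h.ae_sum_mul_eq] with s hs h0 hgt
  obtain ⟨Λ, hΛ, hU, hV⟩ := hs h0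
  have hX := h.2.2.2.2.1 s h0.le
  have hY := h.2.2.2.2.2.1 s h0.le
  obtain ⟨i₀, j₀, hij⟩ : ∃ i₀ j₀, K ≤ (X s * (Y s)ᵀ) i₀ j₀ := by
    by_contra! hlt
    have hle := sum_sq_add_sum_sq_le hX hY fun i j => (hlt i j).le
    simp only [h.sum_sq_sub_sum_sq_eq _ h0.le] at hle
    linarith
  have hneg := sum_Emat_mul_nonpos hp hX hY hΛ hij
  have hsum : ∑ k, ∑ i, ∑ j, Emat p M (X s) (Y s) Λ i j * (X s i k * Y s j k) =
      ∑ i, ∑ j, Emat p M (X s) (Y s) Λ i j * (X s * (Y s)ᵀ) i j := by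
    rw [Finset.sum_comm]
    refine Finset.sum_congr rfl fun i _ => ?_
    rw [Finset.sum_comm]
    refine Finset.sum_congr rfl fun j _ => ?_
    rw [Matrix.mul_apply, Finset.mul_sum]
    rfl
  simp only [← Finset.mul_sum]
  rw [Finset.sum_comm, Finset.sum_comm (f := fun j k => Y s j k * V s j k)]
  simp only [hU, hV]
  linarith
end
end
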